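/- Let U be an even MPO tensor generating a type I or a type II fMPU with antiperiodic boundary conditions, and set V^{(N)} = U^{(N)} in the type I case and V^{(N)} = 2^{−1/2}·U^{(N)} in the type II case (a unitary for every N ≥ 1). Then there exists an integer r ≥ 1, independent of N, such that for every N > 2r, every site j with r < j ≤ N − r, and every matrix O ∈ M_d(ℂ) homogeneous of parity |O| ∈ {0,1} (i.e., P O P = (−1)^{|O|} O with P = diag((−1)^{|0|},…,(−1)^{|d−1|})), there exists a matrix Õ on (ℂ^d)^{⊗(2r+1)}, homogeneous of the same parity |O| with respect to the product grading, with V^{(N)†} ι_j(O) V^{(N)} = (P^{|O|})^{⊗(j−r−1)} ⊗ Õ ⊗ I^{⊗(N−j−r)}. In other words, every type I or type II fMPU with antiperiodic boundary conditions is locality-preserving, i.e., a one-dimensional fermionic quantum cellular automaton. -/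

import Mathlib

open Matrix Kronecker
open scoped ComplexOrder

namespace FQCA

noncomputable section

/-- The sign `(-1)^x` associated with a parity `x ∈ ℤ₂`. -/
def sgn (x : ZMod 2) : ℂ := (-1 : ℂ) ^ x.val

/-- Entrywise complex conjugation of a matrix. -/
def mconj {m n : Type*} (A : Matrix m n ℂ) : Matrix m n ℂ := A.map (starRingEnd ℂ)

/-- A diagonal matrix with diagonal entries `±1`. -/
def IsParityMatrix {ν : Type*} (Z : Matrix ν ν ℂ) : Prop :=
  Z.IsDiag ∧ ∀ α, Z α α = 1 ∨ Z α α = -1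

/-- An even tensor: `Z * A i = (-1)^{|i|} A i * Z`. -/
def EvenTensor {ι ν : Type*} [Fintype ν] (p : ι → ZMod 2)
    (A : ι → Matrix ν ν ℂ) (Z : Matrix ν ν ℂ) : Prop :=
  ∀ i, Z * A i = sgn (p i) • (A i * Z)

/-- The transfer matrix `E_A = Σ_i A^i ⊗ conj (A^i)`. -/
def transfer {ι ν : Type*} [Fintype ι] (A : ι → Matrix ν ν ℂ) :
    Matrix (ν × ν) (ν × ν) ℂ :=
  ∑ i, (A i) ⊗ₖ (mconj (A i))

/-- `P` is the orthogonal projector of a nonzero proper graded invariant subspace for `A`. -/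
def GradedInvariantProj {ι ν : Type*} [Fintype ν] [DecidableEq ν]
    (A : ι → Matrix ν ν ℂ) (Z P : Matrix ν ν ℂ) : Prop :=
  P * P = P ∧ Pᴴ = P ∧ P ≠ 0 ∧ P ≠ 1 ∧ P * Z = Z * P ∧ ∀ i, A i * P = P * (A i * P)

/-- A graded irreducible tensor: no nonzero proper graded invariant subspace. -/
def GradedIrreducible {ι ν : Type*} [Fintype ν] [DecidableEq ν]
    (A : ι → Matrix ν ν ℂ) (Z : Matrix ν ν ℂ) : Prop :=
  ¬ ∃ P, GradedInvariantProj A Z P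

/-- A graded normal tensor, `mult = 1` (non-degenerate) or `2` (degenerate):
graded irreducible, `1` is an eigenvalue of the transfer matrix of algebraic multiplicity
`mult`, and all other eigenvalues have modulus `< 1`. -/
def GradedNormal {ι ν : Type*} [Fintype ι] [Fintype ν] [DecidableEq ν]
    (A : ι → Matrix ν ν ℂ) (Z : Matrix ν ν ℂ) (mult : ℕ) : Prop :=
  GradedIrreducible A Z ∧
  (Matrix.charpoly (transfer A)).rootMultiplicity 1 = mult ∧
  ∀ μ ∈ spectrum ℂ (transfer A), μ ≠ 1 → ‖μ‖ < 1

/-- Graded Canonical Form: `A^i = ⊕ₖ μₖ Aₖ^i` with `Z` block diagonal in the same way and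
every block a graded normal tensor. -/
def GCF {ι ν : Type*} [Fintype ι] [Fintype ν] [DecidableEq ν]
    (p : ι → ZMod 2) (A : ι → Matrix ν ν ℂ) (Z : Matrix ν ν ℂ) : Prop :=
  ∃ (g : ℕ) (Dk : Fin g → ℕ) (e : ν ≃ ((k : Fin g) × Fin (Dk k)))
    (μ : Fin g → ℂ)
    (Ak : (k : Fin g) → ι → Matrix (Fin (Dk k)) (Fin (Dk k)) ℂ)
    (Zk : (k : Fin g) → Matrix (Fin (Dk k)) (Fin (Dk k)) ℂ),
    0 < g ∧
    (∀ i, Matrix.reindex e e (A i) = Matrix.blockDiagonal' (fun k => μ k • Ak k i)) ∧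
    Matrix.reindex e e Z = Matrix.blockDiagonal' Zk ∧
    ∀ k, IsParityMatrix (Zk k) ∧ EvenTensor p (Ak k) (Zk k) ∧
      (GradedNormal (Ak k) (Zk k) 1 ∨ GradedNormal (Ak k) (Zk k) 2)

/-- The coefficient `tr(A^{n₁} ⋯ A^{n_N})` of the fMPS with antiperiodic boundary
conditions generated by the tensor `A`. -/
def mpsCoeff {ι ν : Type*} [Fintype ν] [DecidableEq ν] {N : ℕ}
    (A : ι → Matrix ν ν ℂ) (n : Fin N → ι) : ℂ :=
  ((List.ofFn fun j => A (n j)).prod).trace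

/-- The fermionic sign `σ(n,m) = Σ_{k<j} (|n_j|+|m_j|)·|m_k|` of an fMPO matrix element. -/
def mpoSign {ι : Type*} (p : ι → ZMod 2) {N : ℕ} (n m : Fin N → ι) : ZMod 2 :=
  ∑ jk ∈ Finset.univ.filter (fun jk : Fin N × Fin N => jk.2 < jk.1),
    (p (n jk.1) + p (m jk.1)) * p (m jk.2)

/-- The fMPO with antiperiodic boundary conditions generated by the MPO tensor `U`. -/
def fMPO {ι : Type*} (p : ι → ZMod 2) {ν : Type*} [Fintype ν] [DecidableEq ν]
    (U : ι → ι → Matrix ν ν ℂ) (N : ℕ) :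
    Matrix (Fin N → ι) (Fin N → ι) ℂ :=
  Matrix.of fun n m =>
    sgn (mpoSign p n m) * ((List.ofFn fun j => U (n j) (m j)).prod).trace

/-- The fMPO with periodic boundary conditions generated by the MPO tensor `U`
(parity operator `Z` inserted in the trace). -/
def fMPO_PBC {ι : Type*} (p : ι → ZMod 2) {ν : Type*} [Fintype ν] [DecidableEq ν]
    (Z : Matrix ν ν ℂ) (U : ι → ι → Matrix ν ν ℂ) (N : ℕ) :
    Matrix (Fin N → ι) (Fin N → ι) ℂ :=
  Matrix.of fun n m =>
    sgn (mpoSign p n m) * (Z * (List.ofFn fun j => U (n j) (m j)).prod).trace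

/-- The fermionic blocking sign `τ(n,m) = Σ_{j<l} |m_j|·(|n_l|+|m_l|)`. -/
def blockSign {ι : Type*} (p : ι → ZMod 2) {q : ℕ} (n m : Fin q → ι) : ZMod 2 :=
  ∑ jl ∈ Finset.univ.filter (fun jl : Fin q × Fin q => jl.1 < jl.2),
    p (m jl.1) * (p (n jl.2) + p (m jl.2))

/-- The `q`-fold blocked MPO tensor, with the fermionic blocking signs. -/
def blocked {ι : Type*} (p : ι → ZMod 2) {ν : Type*} [Fintype ν] [DecidableEq ν]
    (U : ι → ι → Matrix ν ν ℂ) (q : ℕ) :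
    (Fin q → ι) → (Fin q → ι) → Matrix ν ν ℂ :=
  fun n m => sgn (blockSign p n m) • ((List.ofFn fun j => U (n j) (m j)).prod)

/-- The right rank `r(U)`: rank of the matrix with entry
`(-1)^{|n||m|} (U^{n,m})_{α,β}` in row `(n,β)` and column `(m,α)`. -/
def rightRank {ι ν : Type*} [Fintype ι] [Fintype ν]
    (p : ι → ZMod 2) (U : ι → ι → Matrix ν ν ℂ) : ℕ :=
  (Matrix.of fun (r c : ι × ν) => sgn (p r.1 * p c.1) * U r.1 c.1 c.2 r.2).rank

/-- The left rank `ℓ(U)`: rank of the matrix with entry `(U^{n,m})_{α,β}`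
in row `(n,α)` and column `(m,β)`. -/
def leftRank {ι ν : Type*} [Fintype ι] [Fintype ν]
    (U : ι → ι → Matrix ν ν ℂ) : ℕ :=
  (Matrix.of fun (r c : ι × ν) => U r.1 c.1 r.2 c.2).rank

/-- The Pauli matrix `σˣ`, indexed by `Bool`. -/
def pauliX : Matrix Bool Bool ℂ := Matrix.of fun a b => if a = b then 0 else 1

/-- The Pauli matrix `σᶻ`, indexed by `Bool`. -/
def pauliZ : Matrix Bool Bool ℂ := Matrix.diagonal (fun b => if b then -1 else 1)

/-- The single-site physical parity matrix `P = diag((-1)^{|i|})`. -/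
def singleP {ι : Type*} [DecidableEq ι] (p : ι → ZMod 2) : Matrix ι ι ℂ :=
  Matrix.diagonal (fun i => sgn (p i))

/-- The parity of the doubled physical index `(n,m)` of an MPO tensor. -/
def doubledP {ι : Type*} (p : ι → ZMod 2) : ι × ι → ZMod 2 :=
  fun nm => p nm.1 + p nm.2

/-- An MPO tensor regarded as a tensor in the doubled physical index. -/
def doubledT {ι ν : Type*} (U : ι → ι → Matrix ν ν ℂ) : ι × ι → Matrix ν ν ℂ :=
  fun nm => U nm.1 nm.2

/-- An MPO tensor rescaled by `c`, regarded as a tensor in the doubled physical index. -/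
def mpoScaled {ι ν : Type*} (c : ℂ) (U : ι → ι → Matrix ν ν ℂ) : ι × ι → Matrix ν ν ℂ :=
  fun nm => c • U nm.1 nm.2

/-- The parity operator `σᶻ ⊗ I` on the bond space `Bool × Fin b`. -/
def ZBP (b : ℕ) : Matrix (Bool × Fin b) (Bool × Fin b) ℂ :=
  pauliZ ⊗ₖ (1 : Matrix (Fin b) (Fin b) ℂ)

/-- Structure of a type II MPO tensor: `U^{n,m} = (σˣ)^{|n|+|m|} ⊗ N^{n,m}`. -/
def TypeIIStruct {d b : ℕ} (p : Fin d → ZMod 2)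
    (U : Fin d → Fin d → Matrix (Bool × Fin b) (Bool × Fin b) ℂ) : Prop :=
  ∃ Nm : Fin d → Fin d → Matrix (Fin b) (Fin b) ℂ,
    ∀ n m', U n m' = (pauliX ^ (p n + p m').val) ⊗ₖ Nm n m'

/-- The parity matrix of the product grading on `q` sites. -/
def bigP {d : ℕ} (p : Fin d → ZMod 2) (q : ℕ) :
    Matrix (Fin q → Fin d) (Fin q → Fin d) ℂ :=
  Matrix.diagonal (fun n => sgn (∑ i, p (n i)))

/-- The Jordan-Wigner embedding at site `j` of a local operator `O` homogeneous of
parity `o`: `P^{|O|} ⊗ ⋯ ⊗ P^{|O|} ⊗ O ⊗ I ⊗ ⋯ ⊗ I`. -/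
def jordanWigner {d N : ℕ} (p : Fin d → ZMod 2) (o : ZMod 2)
    (O : Matrix (Fin d) (Fin d) ℂ) (j : Fin N) :
    Matrix (Fin N → Fin d) (Fin N → Fin d) ℂ :=
  Matrix.of fun n m =>
    (∏ l ∈ Finset.univ.filter (fun l : Fin N => l < j),
      ((singleP p) ^ o.val) (n l) (m l)) *
    O (n j) (m j) *
    (∏ l ∈ Finset.univ.filter (fun l : Fin N => j < l),
      (if n l = m l then (1:ℂ) else 0))

section TraceCharacter

open Polynomial

theorem apply_aeval_X_mul {R : Type*} [Ring R] [Algebra ℂ R] {tr : R →ₗ[ℂ] ℂ} {x : R} {t : ℂ}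
    (h : ∀ k : ℕ, tr (x ^ (k + 1)) = t) (q : ℂ[X]) :
    tr (aeval x (X * q)) = t * q.eval 1 := by
  induction q using Polynomial.induction_on' with
  | add p q hp hq => simp only [mul_add, map_add, eval_add, hp, hq]
  | monomial n c =>
    have : aeval x (X * monomial n c) = c • x ^ (n + 1) := by
      rw [← C_mul_X_pow_eq_monomial, ← mul_assoc, mul_comm X (C c), mul_assoc, ← pow_succ',
        ← smul_eq_C_mul, map_smul, map_pow, aeval_X]
    rw [this, map_smul, h]
    simp [mul_comm]

variable {V : Type*} [AddCommGroup V] [Module ℂ V] [FiniteDimensional ℂ V]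

theorem isNilpotent_of_trace_pow_eq_zero {x : Module.End ℂ V}
    (h : ∀ k : ℕ, LinearMap.trace ℂ V (x ^ (k + 1)) = 0) : IsNilpotent x := by
  have hp : minpoly ℂ x ≠ 0 := minpoly.ne_zero (Algebra.IsIntegral.isIntegral x)
  obtain ⟨g, hg, hdvd⟩ := exists_eq_pow_rootMultiplicity_mul_and_not_dvd _ hp 0
  set m := rootMultiplicity 0 (minpoly ℂ x)
  simp only [C_0, sub_zero] at hg hdvd
  have hcop : IsCoprime (X ^ (m + 1) : ℂ[X]) g :=
    ((irreducible_X.coprime_iff_not_dvd).2 hdvd).pow_left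
  obtain ⟨u, v, huv⟩ := hcop
  have hmin : aeval x (X ^ m * g) = 0 := by rw [← hg, minpoly.aeval]
  have hkill : ∀ q : ℂ[X], aeval x (q * (X ^ m * g)) = 0 := fun q => by
    rw [map_mul, hmin, mul_zero]
  have hidem : IsIdempotentElem (aeval x (X * (u * X ^ m))) := by
    rw [IsIdempotentElem, ← map_mul, ← sub_eq_zero, ← map_sub]
    convert hkill (-(u * v * X)) using 2
    linear_combination (X * (u * X ^ m)) * huv
  have hzero : aeval x (X * (u * X ^ m)) = 0 := by
    apply LinearMap.IsIdempotentElem.eq_zero_of_trace_eq_zero hidem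
    rw [apply_aeval_X_mul (tr := LinearMap.trace ℂ V) h, zero_mul]
  refine ⟨m + 1, ?_⟩
  have : aeval x (X ^ (m + 1) : ℂ[X]) =
      aeval x (X ^ (m + 1) : ℂ[X]) * aeval x (X * (u * X ^ m)) + aeval x ((v * X) * (X ^ m * g)) := by
    rw [← map_mul, ← map_add]
    congr 1
    linear_combination (-X ^ (m + 1)) * huv
  rw [hzero, hkill, mul_zero, zero_add, map_pow, aeval_X] at this
  exact this

/-- Compression of an operator by an idempotent of trace one. -/
theorem exists_compression_eq_smul {e : Module.End ℂ V} (he : IsIdempotentElem e)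
    (htr : LinearMap.trace ℂ V e = 1) (z : Module.End ℂ V) : ∃ c : ℂ, e * z * e = c • e := by
  have hproj : LinearMap.IsProj (LinearMap.range e) e :=
    ⟨fun x => LinearMap.mem_range_self e x, by
      rintro _ ⟨y, rfl⟩
      exact congrArg (fun f : Module.End ℂ V => f y) he⟩
  have h1 : Module.finrank ℂ (LinearMap.range e) = 1 := by
    have := hproj.trace
    rw [htr] at this
    exact_mod_cast this.symm
  obtain ⟨⟨v, hv⟩, -, hspan⟩ := finrank_eq_one_iff'.1 h1
  have hr : ∀ w, ∃ c : ℂ, c • v = e w := fun w => by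
    obtain ⟨c, hc⟩ := hspan ⟨e w, LinearMap.mem_range_self e w⟩
    exact ⟨c, congrArg Subtype.val hc⟩
  obtain ⟨c₀, hc₀⟩ := hr (z v)
  refine ⟨c₀, LinearMap.ext fun w => ?_⟩
  obtain ⟨c, hc⟩ := hr w
  simp only [Module.End.mul_apply, LinearMap.smul_apply, ← hc, map_smul, ← hc₀]
  rw [smul_comm]

/-- A multiplicatively closed space of nilpotent operators is nilpotent. -/
theorem exists_pow_eq_bot_of_forall_isNilpotent (J : Submodule ℂ (Module.End ℂ V))
    (hmul : J * J ≤ J) (hnil : ∀ x ∈ J, IsNilpotent x) : ∃ K : ℕ, J ^ K = ⊥ := by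
  let _ : LieRing (Module.End ℂ V) := LieRing.ofAssociativeRing
  let L : LieSubalgebra ℂ (Module.End ℂ V) :=
    { J with
      lie_mem' := fun {x y} hx hy => by
        rw [Ring.lie_def]
        exact J.sub_mem (hmul (Submodule.mul_mem_mul hx hy))
          (hmul (Submodule.mul_mem_mul hy hx)) }
  have hL : LieModule.IsNilpotent L V := by
    rw [LieModule.isNilpotent_iff_forall' (R := ℂ)]
    rintro ⟨x, hx⟩
    exact hnil x hx
  obtain ⟨K, hK⟩ := (LieModule.isNilpotent_iff ℂ L V).1 hL
  have key : ∀ k, ∀ x ∈ J ^ k, ∀ v : V, x v ∈ LieModule.lowerCentralSeries ℂ L V k := by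
    intro k
    induction k with
    | zero => intro x _ v; simp
    | succ k ih =>
      intro x hx v
      replace hx : x ∈ J * J ^ k := by
        have hpow : J ^ (k + 1) = J * J ^ k := pow_succ' J k
        exact hpow ▸ hx
      induction hx using Submodule.mul_induction_on' with
      | mem_mul_mem a ha b hb =>
        rw [LieModule.lowerCentralSeries_succ]
        exact LieSubmodule.lie_mem_lie (x := (⟨a, ha⟩ : L)) (LieSubmodule.mem_top _) (ih b hb v)
      | add x _ y _ hx hy => exact add_mem hx hy
  refine ⟨K, (Submodule.eq_bot_iff _).2 fun x hx => LinearMap.ext fun v => ?_⟩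
  have := key K x hx v
  rw [hK] at this
  simpa using this

/-- If `tr` is multiplicative on words in the letters `a i`, then sufficiently long words on
both sides absorb the letters in between. -/
theorem exists_absorb_of_nil {R : Type*} [Ring R] [Algebra ℂ R] {tr : R →ₗ[ℂ] ℂ}
    (hnilp : ∀ x : R, (∀ k : ℕ, tr (x ^ (k + 1)) = 0) → IsNilpotent x)
    (hcompress : ∀ e z : R, IsIdempotentElem e → tr e = 1 → ∃ c : ℂ, e * z * e = c • e)
    (hengel : ∀ J : Submodule ℂ R, J * J ≤ J → (∀ x ∈ J, IsNilpotent x) → ∃ K : ℕ, J ^ K = ⊥)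
    {ι : Type*} (a : ι → R) (χ : ι → ℂ)
    (htr : ∀ l : List ι, l ≠ [] → tr (l.map a).prod = (l.map χ).prod)
    (e : ι) (he : χ e = 1) :
    ∃ K : ℕ, ∀ u v w : List ι, u.length = K → v.length = K →
      (u.map a).prod * (w.map a).prod * (v.map a).prod =
        (w.map χ).prod • ((u.map a).prod * a e ^ w.length * (v.map a).prod) := by
  have mulR : ∀ {M N Q : Submodule ℂ R}, N ≤ Q → M * N ≤ M * Q := fun h => mul_le_mul' le_rfl h
  have mulL : ∀ {M N Q : Submodule ℂ R}, N ≤ Q → N * M ≤ Q * M := fun h => mul_le_mul' h le_rfl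
  let A : Submodule ℂ R :=
    Submodule.span ℂ {x | ∃ l : List ι, l ≠ [] ∧ (l.map a).prod = x}
  have hword : ∀ l : List ι, l ≠ [] → (l.map a).prod ∈ A := fun l hl =>
    Submodule.subset_span ⟨l, hl, rfl⟩
  have hAA : A * A ≤ A := by
    rw [Submodule.span_mul_span, Submodule.span_le]
    rintro _ ⟨_, ⟨l, hl, rfl⟩, _, ⟨l', hl', rfl⟩, rfl⟩
    have := hword (l ++ l') (by simp [hl])
    simpa using this
  have hmulA : ∀ {x y}, x ∈ A → y ∈ A → x * y ∈ A := fun hx hy =>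
    hAA (Submodule.mul_mem_mul hx hy)
  have htrmul : ∀ x ∈ A, ∀ y ∈ A, tr (x * y) = tr x * tr y := by
    intro x hx y hy
    induction hx, hy using Submodule.span_induction₂ with
    | mem_mem x y hx hy =>
      obtain ⟨l, hl, rfl⟩ := hx
      obtain ⟨l', hl', rfl⟩ := hy
      have := htr (l ++ l') (by simp [hl])
      rw [htr l hl, htr l' hl']
      simpa using this
    | zero_left => simp
    | zero_right => simp
    | add_left x y z _ _ _ h1 h2 => simp only [add_mul, map_add, h1, h2]
    | add_right x y z _ _ _ h1 h2 => simp only [mul_add, map_add, h1, h2]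
    | smul_left r x y _ _ h => simp only [smul_mul_assoc, map_smul, h, smul_eq_mul, mul_assoc]
    | smul_right r x y _ _ h =>
      simp only [mul_smul_comm, map_smul, h, smul_eq_mul]; ring
  let J : Submodule ℂ R := A ⊓ LinearMap.ker tr
  have hJA : J ≤ A := inf_le_left
  have hJAJ : J * A ≤ J := Submodule.mul_le.2 fun x hx y hy =>
    ⟨hmulA hx.1 hy, by
      change tr _ = 0
      rw [htrmul x hx.1 y hy, show tr x = 0 from hx.2, zero_mul]⟩
  have hAJJ : A * J ≤ J := Submodule.mul_le.2 fun x hx y hy =>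
    ⟨hmulA hx hy.1, by
      change tr _ = 0
      rw [htrmul x hx y hy.1, show tr y = 0 from hy.2, mul_zero]⟩
  have hJJ : J * J ≤ J := (mulR hJA).trans hJAJ
  have hnil : ∀ x ∈ J, IsNilpotent x := by
    intro x hx
    apply hnilp
    intro k
    have : x ^ (k + 1) ∈ J := by
      induction k with
      | zero => simpa using hx
      | succ k ih => rw [pow_succ]; exact hJJ (Submodule.mul_mem_mul ih hx)
    exact this.2
  obtain ⟨K, hK⟩ := hengel J hJJ hnil
  -- an idempotent of trace one
  have hEA : a e ∈ A := by simpa using hword [e] (by simp)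
  have hEtr : ∀ k : ℕ, tr (a e ^ (k + 1)) = 1 := fun k => by
    have := htr (List.replicate (k + 1) e) (by simp)
    simpa [he] using this
  have hpolyA : ∀ q : ℂ[X], aeval (a e) (X * q) ∈ A := by
    intro q
    induction q using Polynomial.induction_on' with
    | add p q hp hq => rw [mul_add, map_add]; exact A.add_mem hp hq
    | monomial n c =>
      have : aeval (a e) (X * monomial n c) = c • ((List.replicate (n + 1) e).map a).prod := by
        rw [← C_mul_X_pow_eq_monomial, ← mul_assoc, mul_comm X (C c), mul_assoc, ← pow_succ',
          ← smul_eq_C_mul, map_smul, map_pow, aeval_X]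
        simp
      rw [this]
      exact A.smul_mem _ (hword _ (by simp))
  obtain ⟨E, hE, hEidem, hE1⟩ :
      ∃ E ∈ A, IsIdempotentElem E ∧ tr E = 1 := by
    have hmem : a e * a e - a e ∈ J := by
      refine ⟨A.sub_mem (hmulA hEA hEA) hEA, ?_⟩
      have h0 := hEtr 0
      have h1 := hEtr 1
      rw [zero_add, pow_one] at h0
      rw [one_add_one_eq_two, pow_two] at h1
      change tr _ = 0
      rw [map_sub, h0, h1, sub_self]
    obtain ⟨k, hk⟩ := hnil _ hmem
    have hk' : aeval (a e) ((X * (X - 1)) ^ (k + 1) : ℂ[X]) = 0 := by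
      have : aeval (a e) (X * (X - 1) : ℂ[X]) = a e * a e - a e := by
        simp [mul_sub]
      rw [map_pow, this, pow_succ, hk, zero_mul]
    have hcop : IsCoprime (X ^ (k + 1) : ℂ[X]) ((X - 1) ^ (k + 1)) := by
      apply IsCoprime.pow
      exact ⟨1, -1, by ring⟩
    obtain ⟨u, v, huv⟩ := hcop
    refine ⟨aeval (a e) (X * (u * X ^ k)), hpolyA _, ?_, ?_⟩
    · rw [IsIdempotentElem, ← map_mul, ← sub_eq_zero, ← map_sub]
      have : (X * (u * X ^ k)) * (X * (u * X ^ k)) - X * (u * X ^ k) =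
          -(u * v) * (X * (X - 1) : ℂ[X]) ^ (k + 1) := by
        rw [mul_pow]
        linear_combination (X * (u * X ^ k)) * huv
      rw [this, map_mul, hk', mul_zero]
    · rw [apply_aeval_X_mul hEtr, one_mul]
      have := congrArg (Polynomial.eval 1) huv
      simpa using this
  have hEJE : ∀ z ∈ J, E * z * E = 0 := by
    intro z hz
    obtain ⟨c, hc⟩ := hcompress E z hEidem hE1
    have h2 := congrArg tr hc
    rw [htrmul _ (hmulA hE hz.1) _ hE, htrmul _ hE _ hz.1, show tr z = 0 from hz.2, map_smul,
      hE1, smul_eq_mul] at h2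
    have : c = 0 := by linear_combination -h2
    rw [hc, this, zero_smul]
  -- powers of `A`
  let S : Submodule ℂ R := Submodule.span ℂ {E}
  have hAS : A ≤ S ⊔ J := by
    intro x hx
    have : x = tr x • E + (x - tr x • E) := by abel
    rw [this]
    refine Submodule.add_mem_sup (Submodule.smul_mem _ _ (Submodule.mem_span_singleton_self E))
      ⟨A.sub_mem hx (A.smul_mem _ hE), ?_⟩
    change tr _ = 0
    rw [map_sub, map_smul, hE1, smul_eq_mul, mul_one, sub_self]
  have hright : ∀ k, A ^ k ≤ J ^ k ⊔ ⊤ * S * (1 ⊔ A) := by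
    intro k
    induction k with
    | zero => simp
    | succ k ih =>
      rw [pow_succ, pow_succ]
      refine (mulL ih).trans ?_
      rw [Submodule.sup_mul]
      refine sup_le ?_ ?_
      · refine (mulR hAS).trans ?_
        rw [Submodule.mul_sup]
        refine sup_le (le_sup_of_le_right ?_) le_sup_left
        rw [← mul_one (J ^ k * S)]
        exact mul_le_mul' (mulL le_top) le_sup_left
      · refine le_sup_of_le_right ?_
        rw [mul_assoc]
        refine mulR ?_
        rw [Submodule.sup_mul, one_mul]
        exact le_sup_of_le_right (sup_le le_rfl hAA)
  have hleft : ∀ k, A ^ k ≤ J ^ k ⊔ (1 ⊔ A) * S * ⊤ := by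
    intro k
    induction k with
    | zero => simp
    | succ k ih =>
      rw [pow_succ', pow_succ']
      refine (mulR ih).trans ?_
      rw [Submodule.mul_sup]
      refine sup_le ?_ ?_
      · refine (mulL hAS).trans ?_
        rw [Submodule.sup_mul]
        refine sup_le (le_sup_of_le_right ?_) le_sup_left
        refine mul_le_mul' ?_ le_top
        conv_lhs => rw [← one_mul S]
        exact mulL le_sup_left
      · refine le_sup_of_le_right ?_
        rw [← mul_assoc, ← mul_assoc]
        refine mulL (mulL ?_)
        rw [Submodule.mul_sup, mul_one]
        exact le_sup_of_le_right (sup_le le_rfl hAA)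
  have hSJS : S * J * S = ⊥ := by
    rw [eq_bot_iff]
    refine Submodule.mul_le.2 fun x hx y hy => ?_
    obtain ⟨c, rfl⟩ := Submodule.mem_span_singleton.1 hy
    induction hx using Submodule.mul_induction_on' with
    | mem_mul_mem s hs z hz =>
      obtain ⟨c', rfl⟩ := Submodule.mem_span_singleton.1 hs
      simp [hEJE z hz]
    | add x _ y _ h1 h2 => rw [add_mul]; exact add_mem h1 h2
  have hsandwich : A ^ K * J * A ^ K = ⊥ := by
    have h1 := hright K
    have h2 := hleft K
    rw [hK, bot_sup_eq] at h1 h2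
    have h3 : (1 ⊔ A) * J * (1 ⊔ A) ≤ J := by
      have : (1 ⊔ A) * J ≤ J := by
        rw [Submodule.sup_mul, one_mul]; exact sup_le le_rfl hAJJ
      refine (mulL this).trans ?_
      rw [Submodule.mul_sup, mul_one]; exact sup_le le_rfl hJAJ
    rw [eq_bot_iff]
    calc A ^ K * J * A ^ K
        ≤ (⊤ * S * (1 ⊔ A)) * J * ((1 ⊔ A) * S * ⊤) :=
          mul_le_mul' (mulL h1) h2
      _ = ⊤ * (S * ((1 ⊔ A) * J * (1 ⊔ A)) * S) * ⊤ := by simp only [mul_assoc]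
      _ ≤ ⊤ * (S * J * S) * ⊤ :=
          mulL (mulR
            (mulL (mulR h3)))
      _ = ⊥ := by rw [hSJS]; simp
  have hpow : ∀ u : List ι, (u.map a).prod ∈ A ^ u.length := by
    intro u
    induction u with
    | nil => exact Submodule.one_le.1 le_rfl
    | cons i u ih =>
      rw [List.map_cons, List.prod_cons, List.length_cons, pow_succ']
      refine Submodule.mul_mem_mul ?_ ih
      simpa using hword [i] (by simp)
  refine ⟨K, fun u v w hu hv => ?_⟩
  rcases eq_or_ne w [] with rfl | hw
  · simp
  have hz : (w.map a).prod - (w.map χ).prod • a e ^ w.length ∈ J := by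
    have hrep : a e ^ w.length = ((List.replicate w.length e).map a).prod := by simp
    have hne : List.replicate w.length e ≠ [] := by simpa using hw
    refine ⟨A.sub_mem (hword w hw) (A.smul_mem _ (hrep ▸ hword _ hne)), ?_⟩
    change tr _ = 0
    rw [map_sub, map_smul, hrep, htr w hw, htr _ hne]
    simp [he]
  have hmem : (u.map a).prod * ((w.map a).prod - (w.map χ).prod • a e ^ w.length) *
      (v.map a).prod ∈ A ^ K * J * A ^ K :=
    Submodule.mul_mem_mul (Submodule.mul_mem_mul (hu ▸ hpow u) hz) (hv ▸ hpow v)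
  rw [hsandwich, Submodule.mem_bot, mul_sub, sub_mul, sub_eq_zero] at hmem
  rw [hmem, mul_smul_comm, smul_mul_assoc]

/-- If the trace is multiplicative on words in the matrices `a i`, then sufficiently long words on
both sides absorb the letters in between. -/
theorem exists_absorb_of_trace {n ι : Type*} [Fintype n] [DecidableEq n]
    (a : ι → Matrix n n ℂ) (χ : ι → ℂ)
    (htr : ∀ l : List ι, l ≠ [] → (l.map a).prod.trace = (l.map χ).prod)
    (e : ι) (he : χ e = 1) :
    ∃ K : ℕ, ∀ u v w : List ι, u.length = K → v.length = K →
      (u.map a).prod * (w.map a).prod * (v.map a).prod =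
        (w.map χ).prod • ((u.map a).prod * a e ^ w.length * (v.map a).prod) := by
  let φ : Matrix n n ℂ ≃ₐ[ℂ] Module.End ℂ (n → ℂ) := Matrix.toLinAlgEquiv'
  have hφtr : ∀ x, LinearMap.trace ℂ (n → ℂ) (φ x) = x.trace := fun x => by
    exact Matrix.trace_toLin'_eq x
  refine exists_absorb_of_nil (tr := Matrix.traceLinearMap n ℂ ℂ) ?_ ?_ ?_ a χ htr e he
  · intro x hx
    rw [← IsNilpotent.map_iff φ.injective]
    apply isNilpotent_of_trace_pow_eq_zero
    intro k
    rw [← map_pow, hφtr]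
    exact hx k
  · intro e z hee he1
    obtain ⟨c, hc⟩ := exists_compression_eq_smul (hee.map φ) ((hφtr e).trans he1) (φ z)
    refine ⟨c, φ.injective ?_⟩
    rw [map_mul, map_mul, hc, map_smul]
  · intro J hJ hnil
    obtain ⟨K, hK⟩ := exists_pow_eq_bot_of_forall_isNilpotent (J.map φ.toAlgHom.toLinearMap)
      (by rw [← Submodule.map_mul]; exact Submodule.map_mono hJ)
      (by
        rintro _ ⟨x, hx, rfl⟩
        exact (hnil x hx).map φ)
    refine ⟨K, ?_⟩
    have hmap : (J ^ K).map φ.toAlgHom.toLinearMap = ⊥ := by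
      rw [Submodule.map_pow]; exact hK
    exact Submodule.map_injective_of_injective φ.injective (hmap.trans (Submodule.map_bot _).symm)

end TraceCharacter

section Signs

theorem eq_zero_or_eq_one (a : ZMod 2) : a = 0 ∨ a = 1 := by
  revert a; decide

theorem sgn_zero : sgn 0 = 1 := by simp [sgn]

theorem sgn_one : sgn 1 = -1 := by simp [sgn, ZMod.val_one]

theorem sgn_add (a b : ZMod 2) : sgn (a + b) = sgn a * sgn b := by
  obtain rfl | rfl := eq_zero_or_eq_one a <;> obtain rfl | rfl := eq_zero_or_eq_one b <;>
    simp [sgn_zero, sgn_one, CharTwo.add_self_eq_zero]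

theorem sgn_mul_self (a : ZMod 2) : sgn a * sgn a = 1 := by
  rw [← sgn_add, CharTwo.add_self_eq_zero, sgn_zero]

theorem sgn_ne_zero (a : ZMod 2) : sgn a ≠ 0 := fun h => by
  simpa [h] using sgn_mul_self a

theorem star_sgn (a : ZMod 2) : star (sgn a) = sgn a := by simp [sgn]

theorem sgn_of_ne_zero {a : ZMod 2} (h : a ≠ 0) : sgn a = -1 := by
  rw [(eq_zero_or_eq_one a).resolve_left h, sgn_one]

theorem sgn_sum {ι : Type*} (s : Finset ι) (f : ι → ZMod 2) :
    sgn (∑ i ∈ s, f i) = ∏ i ∈ s, sgn (f i) := by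
  classical
  induction s using Finset.induction_on with
  | empty => simp [sgn_zero]
  | insert i s hi ih => rw [Finset.sum_insert hi, Finset.prod_insert hi, sgn_add, ih]

/-- The identity between the fermionic signs of a conjugated local operator and the signs
produced by reordering parity operators on the bonds. -/
theorem sign_identity {N : ℕ} (x y z : Fin N → ZMod 2) (j : Fin N) (o : ZMod 2)
    (h : ∑ i, (x i + z i) = 0) :
    (∑ i, ∑ l, if l < i then ((x i + if i = j then o else 0) + y i) * y l else 0) +
        (∑ i, ∑ l, if l < i then (x i + z i) * z l else 0) +
        o * (∑ l, if l < j then x l else 0) =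
      ((∑ i, ∑ l, if l < i then (y i + z i) * y l else 0) +
          o * ∑ l, if l < j then y l + z l else 0) +
        o * (x j + z j) +
        ∑ i, ∑ l, if l < i then (x i + z i) * (y l + z l + if l = j then o else 0) else 0 := by
  have h1 : (∑ i, ∑ l, if l < i then ((x i + if i = j then o else 0) + y i) * y l else 0) =
      (∑ i, ∑ l, if l < i then (x i + y i) * y l else 0) +
        o * ∑ l, if l < j then y l else 0 := by
    have : o * (∑ l, if l < j then y l else 0) =
        ∑ i, ∑ l, if l < i then (if i = j then o else 0) * y l else 0 := by
      symm
      rw [Finset.sum_eq_single j]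
      · simp [Finset.mul_sum]
      · intro i _ hi; simp [hi]
      · simp
    rw [this]
    simp_rw [← Finset.sum_add_distrib]
    refine Finset.sum_congr rfl fun i _ => Finset.sum_congr rfl fun l _ => ?_
    split_ifs <;> ring
  have h2 : (∑ i, ∑ l, if l < i then (x i + z i) * (y l + z l + if l = j then o else 0) else 0) =
      (∑ i, ∑ l, if l < i then (x i + z i) * (y l + z l) else 0) +
        o * ∑ i, if j < i then x i + z i else 0 := by
    have : o * (∑ i, if j < i then x i + z i else 0) =
        ∑ i, ∑ l, if l < i then (x i + z i) * (if l = j then o else 0) else 0 := by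
      rw [Finset.mul_sum]
      refine Finset.sum_congr rfl fun i _ => ?_
      rw [Finset.sum_eq_single j]
      · split_ifs <;> simp_all [mul_comm]
      · intro l _ hl; simp [hl]
      · simp
    rw [this]
    simp_rw [← Finset.sum_add_distrib]
    refine Finset.sum_congr rfl fun i _ => Finset.sum_congr rfl fun l _ => ?_
    split_ifs <;> ring
  have h3 : (∑ i, ∑ l, if l < i then (x i + y i) * y l else 0) +
      (∑ i, ∑ l, if l < i then (x i + z i) * z l else 0) =
      (∑ i, ∑ l, if l < i then (y i + z i) * y l else 0) +
      ∑ i, ∑ l, if l < i then (x i + z i) * (y l + z l) else 0 := by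
    simp_rw [← Finset.sum_add_distrib]
    refine Finset.sum_congr rfl fun i _ => Finset.sum_congr rfl fun l _ => ?_
    split_ifs
    · linear_combination (-z i * y l) * (CharTwo.two_eq_zero : (2 : ZMod 2) = 0)
    · ring
  have h4 : (∑ l, if l < j then x l else 0) + (∑ l, if l < j then y l else 0) +
      (∑ l, if l < j then y l + z l else 0) + (x j + z j) +
      (∑ i, if j < i then x i + z i else 0) = 0 := by
    refine Eq.trans ?_ h
    have hj : x j + z j = ∑ i, if i = j then x i + z i else 0 := by simp
    rw [hj]
    simp_rw [← Finset.sum_add_distrib]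
    refine Finset.sum_congr rfl fun i _ => ?_
    rcases lt_trichotomy i j with hlt | rfl | hlt
    · simp only [hlt, hlt.ne, not_lt.2 hlt.le, if_true, if_false]
      linear_combination (y i) * (CharTwo.two_eq_zero : (2 : ZMod 2) = 0)
    · simp
    · simp [hlt, hlt.ne', not_lt.2 hlt.le]
  rw [h1, h2]
  linear_combination h3 + o * h4 - o * ((∑ l, if l < j then y l + z l else 0) + (x j + z j) +
      (∑ i, if j < i then x i + z i else 0)) * (CharTwo.two_eq_zero : (2 : ZMod 2) = 0)

end Signs

section OrderedProducts

variable {R : Type*} [Ring R] {N : ℕ}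

theorem pow_val_add {Y : R} (hY : Y * Y = 1) (a b : ZMod 2) :
    Y ^ (a + b).val = Y ^ a.val * Y ^ b.val := by
  obtain rfl | rfl := eq_zero_or_eq_one a <;> obtain rfl | rfl := eq_zero_or_eq_one b <;>
    simp [ZMod.val_one, CharTwo.add_self_eq_zero, hY]

theorem prod_ofFn_sum {κ : Type*} [Fintype κ] (f : Fin N → κ → R) :
    (List.ofFn fun i => ∑ k, f i k).prod = ∑ k : Fin N → κ, (List.ofFn fun i => f i (k i)).prod := by
  induction N with
  | zero => simp
  | succ N ih =>
    rw [List.ofFn_succ, List.prod_cons, ih fun i => f i.succ, Finset.sum_mul_sum,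
      ← (Fin.consEquiv fun _ => κ).sum_comp, Fintype.sum_prod_type]
    simp [Fin.consEquiv]

variable [Algebra ℂ R]

theorem mul_pow_val_of_graded {Y M : R} {q : ZMod 2} (h : Y * M = sgn q • (M * Y)) (b : ZMod 2) :
    M * Y ^ b.val = sgn (b * q) • (Y ^ b.val * M) := by
  obtain rfl | rfl := eq_zero_or_eq_one b
  · simp [sgn_zero]
  · simp [ZMod.val_one, h, smul_smul, sgn_mul_self]

theorem graded_mul {Y A B : R} {q s : ZMod 2} (hA : Y * A = sgn q • (A * Y))
    (hB : Y * B = sgn s • (B * Y)) : Y * (A * B) = sgn (q + s) • (A * B * Y) := by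
  rw [← mul_assoc, hA, smul_mul_assoc, mul_assoc, hB, mul_smul_comm, smul_smul, sgn_add,
    mul_assoc]

theorem graded_prod_ofFn {Y : R} (M : Fin N → R) (q : Fin N → ZMod 2)
    (hM : ∀ i, Y * M i = sgn (q i) • (M i * Y)) :
    Y * (List.ofFn M).prod = sgn (∑ i, q i) • ((List.ofFn M).prod * Y) := by
  induction N with
  | zero => simp [sgn_zero]
  | succ N ih =>
    rw [List.ofFn_succ, List.prod_cons, Fin.sum_univ_succ]
    exact graded_mul (hM 0) (ih _ _ fun i => hM i.succ)

/-- Moving graded insertions to the left of an ordered product. -/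
theorem prod_ofFn_twist {Y : R} (hY : Y * Y = 1) (M : Fin N → R) (a q : Fin N → ZMod 2)
    (hM : ∀ i, Y * M i = sgn (q i) • (M i * Y)) :
    (List.ofFn fun i => Y ^ (a i).val * M i).prod =
      sgn (∑ i, ∑ l, if l < i then a i * q l else 0) •
        (Y ^ (∑ i, a i).val * (List.ofFn M).prod) := by
  induction N with
  | zero => simp [sgn_zero]
  | succ N ih =>
    rw [List.ofFn_succ, List.prod_cons, ih _ _ _ fun i => hM i.succ, List.ofFn_succ, List.prod_cons,
      Fin.sum_univ_succ a, pow_val_add hY]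
    have hs : (∑ i, ∑ l, if l < i then a i * q l else 0) =
        (∑ i : Fin N, a i.succ) * q 0 +
          ∑ i : Fin N, ∑ l : Fin N, if l < i then a i.succ * q l.succ else 0 := by
      simp [Fin.sum_univ_succ, Finset.sum_add_distrib, Finset.sum_mul]
    rw [hs, sgn_add, mul_smul_comm, mul_comm (sgn _), mul_smul]
    congr 1
    rw [mul_assoc, ← mul_assoc (M 0), mul_pow_val_of_graded (hM 0), smul_mul_assoc, mul_smul_comm]
    simp only [mul_assoc]

theorem prod_ofFn_smul (c : Fin N → ℂ) (f : Fin N → R) :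
    (List.ofFn fun i => c i • f i).prod = (∏ i, c i) • (List.ofFn f).prod := by
  induction N with
  | zero => simp
  | succ N ih =>
    rw [List.ofFn_succ, List.prod_cons, ih, List.ofFn_succ, List.prod_cons, Fin.prod_univ_succ,
      smul_mul_smul_comm]

end OrderedProducts

section Bonds

theorem mconj_smul {ν : Type*} (c : ℂ) (A : Matrix ν ν ℂ) : mconj (c • A) = star c • mconj A := by
  ext; simp [mconj]

theorem mconj_one {ν : Type*} [DecidableEq ν] : mconj (1 : Matrix ν ν ℂ) = 1 := by
  simp [mconj]

variable {ν : Type*} [Fintype ν]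

theorem mconj_mul (A B : Matrix ν ν ℂ) : mconj (A * B) = mconj A * mconj B :=
  Matrix.map_mul

theorem trace_mconj (A : Matrix ν ν ℂ) : (mconj A).trace = star A.trace := by
  simp [mconj, Matrix.trace]

theorem graded_mconj {Z A : Matrix ν ν ℂ} {q : ZMod 2} (h : Z * A = sgn q • (A * Z)) :
    mconj Z * mconj A = sgn q • (mconj A * mconj Z) := by
  rw [← mconj_mul, h, mconj_smul, star_sgn, mconj_mul]

theorem graded_kronecker {Z Z' A A' : Matrix ν ν ℂ} {q q' : ZMod 2}
    (h : Z * A = sgn q • (A * Z)) (h' : Z' * A' = sgn q' • (A' * Z')) :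
    (Z ⊗ₖ Z') * (A ⊗ₖ A') = sgn (q + q') • ((A ⊗ₖ A') * (Z ⊗ₖ Z')) := by
  rw [← Matrix.mul_kronecker_mul, h, h', Matrix.smul_kronecker, Matrix.kronecker_smul, smul_smul,
    sgn_add, Matrix.mul_kronecker_mul]

theorem trace_mul_eq_zero_of_graded {Z A : Matrix ν ν ℂ} {q : ZMod 2} (hq : q ≠ 0)
    (h : Z * A = sgn q • (A * Z)) : (Z * A).trace = 0 := by
  have := congrArg Matrix.trace h
  rw [Matrix.trace_smul, Matrix.trace_mul_comm A Z, sgn_of_ne_zero hq, smul_eq_mul] at this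
  linear_combination this / 2

variable [DecidableEq ν] {N : ℕ}

theorem mconj_prod_ofFn (A : Fin N → Matrix ν ν ℂ) :
    mconj (List.ofFn A).prod = (List.ofFn fun i => mconj (A i)).prod := by
  induction N with
  | zero => simp [mconj_one]
  | succ N ih => simp [List.ofFn_succ, mconj_mul, ih]

theorem kronecker_prod_ofFn (A B : Fin N → Matrix ν ν ℂ) :
    (List.ofFn fun i => A i ⊗ₖ B i).prod = (List.ofFn A).prod ⊗ₖ (List.ofFn B).prod := by
  induction N with
  | zero => simp
  | succ N ih => simp [List.ofFn_succ, Matrix.mul_kronecker_mul, ih]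

theorem trace_eq_zero_of_graded {Z A : Matrix ν ν ℂ} (hZ : Z * Z = 1) {q : ZMod 2} (hq : q ≠ 0)
    (h : Z * A = sgn q • (A * Z)) : A.trace = 0 := by
  have h2 := congrArg (fun M => (Z * M).trace) h
  simp only [mul_smul_comm, Matrix.trace_smul] at h2
  rw [← mul_assoc, hZ, one_mul, Matrix.trace_mul_comm, mul_assoc, hZ, mul_one,
    sgn_of_ne_zero hq, smul_eq_mul] at h2
  linear_combination h2 / 2

end Bonds

section Layers

variable {d N : ℕ}

theorem singleP_pow_apply (p : Fin d → ZMod 2) (o : ZMod 2) (a b : Fin d) :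
    (singleP p ^ o.val) a b = if a = b then sgn (o * p a) else 0 := by
  obtain rfl | rfl := eq_zero_or_eq_one o
  · simp [sgn_zero, Matrix.one_apply]
  · simp [ZMod.val_one, singleP, Matrix.diagonal_apply]

theorem apply_eq_zero_of_singleP_conj {p : Fin d → ZMod 2} {o : ZMod 2}
    {O : Matrix (Fin d) (Fin d) ℂ} (hO : singleP p * O * singleP p = sgn o • O) {a b : Fin d}
    (h : p a + p b ≠ o) : O a b = 0 := by
  have h1 := congrFun (congrFun hO a) b
  simp only [singleP, Matrix.mul_diagonal, Matrix.diagonal_mul, Matrix.smul_apply,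
    smul_eq_mul] at h1
  have h2 : sgn (p a + p b + o) = -1 :=
    sgn_of_ne_zero fun h' => h (CharTwo.add_eq_zero.1 h')
  rw [sgn_add, sgn_add] at h2
  have h3 := sgn_mul_self o
  linear_combination (O a b * h2 - sgn o * h1 - O a b * h3) / 2

theorem jordanWigner_apply (p : Fin d → ZMod 2) (o : ZMod 2) (O : Matrix (Fin d) (Fin d) ℂ)
    (j : Fin N) (n m : Fin N → Fin d) :
    jordanWigner p o O j n m = if ∀ l, l ≠ j → n l = m l then
      sgn (o * ∑ l, if l < j then p (m l) else 0) * O (n j) (m j) else 0 := by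
  rw [jordanWigner, Matrix.of_apply]
  split_ifs with h
  · rw [Finset.prod_eq_one fun l hl => if_pos (h l (Finset.mem_filter.1 hl).2.ne'), mul_one,
      ← Finset.sum_filter, Finset.mul_sum, sgn_sum]
    congr 1
    refine Finset.prod_congr rfl fun l hl => ?_
    rw [singleP_pow_apply, if_pos (h l (Finset.mem_filter.1 hl).2.ne),
      h l (Finset.mem_filter.1 hl).2.ne]
  · push Not at h
    obtain ⟨l, hlj, hl⟩ := h
    rcases lt_or_gt_of_ne hlj with h' | h'
    · rw [Finset.prod_eq_zero (i := l) (by simpa using h') (by simp [singleP_pow_apply, hl]),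
        zero_mul, zero_mul]
    · rw [mul_eq_zero]
      exact Or.inr (Finset.prod_eq_zero (i := l) (by simpa using h') (if_neg hl))

theorem jordanWigner_zero_one (p : Fin d → ZMod 2) (j : Fin N) : jordanWigner p 0 1 j = 1 := by
  ext n m
  rw [jordanWigner_apply, Matrix.one_apply, Matrix.one_apply, zero_mul, sgn_zero, one_mul,
    ← ite_and]
  refine if_congr ⟨fun h => funext fun l => ?_, fun h => by simp [h]⟩ rfl rfl
  by_cases hl : l = j
  · exact hl ▸ h.2
  · exact h.1 l hl

theorem mpoSign_eq_sum {ι : Type*} (p : ι → ZMod 2) (n m : Fin N → ι) :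
    mpoSign p n m = ∑ i, ∑ l, if l < i then (p (n i) + p (m i)) * p (m l) else 0 := by
  rw [mpoSign, Finset.sum_filter, Fintype.sum_prod_type]

variable {ν : Type*} [Fintype ν] [DecidableEq ν]

/-- The double-layer bond matrix obtained by sandwiching the local operator `O`, of parity `o`,
between a tensor and its conjugate. -/
def layer (p : Fin d → ZMod 2) (Z : Matrix ν ν ℂ) (U : Fin d → Fin d → Matrix ν ν ℂ)
    (o : ZMod 2) (O : Matrix (Fin d) (Fin d) ℂ) (n m : Fin d) : Matrix (ν × ν) (ν × ν) ℂ :=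
  ∑ k : Fin d × Fin d, (O k.1 k.2 * sgn (o * (p k.2 + p m))) •
    ((mconj Z ⊗ₖ Z) ^ (p k.2 + p m).val * (mconj (U k.1 n) ⊗ₖ U k.2 m))

theorem kronecker_mconj_mul_self {Z : Matrix ν ν ℂ} (hZ : Z * Z = 1) :
    (mconj Z ⊗ₖ Z) * (mconj Z ⊗ₖ Z) = 1 := by
  rw [← Matrix.mul_kronecker_mul, ← mconj_mul, hZ, mconj_one, Matrix.one_kronecker_one]

theorem conj_entry_term {p : Fin d → ZMod 2} {Z : Matrix ν ν ℂ} (hZ : Z * Z = 1)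
    {U : Fin d → Fin d → Matrix ν ν ℂ} (hU : ∀ n m, Z * U n m = sgn (p n + p m) • (U n m * Z))
    (o : ZMod 2) (j : Fin N) (k k' n m : Fin N → Fin d)
    (hk : ∀ l, p (k l) = p (k' l) + if l = j then o else 0) :
    sgn (mpoSign p k n) * star (List.ofFn fun l => U (k l) (n l)).prod.trace *
        sgn (o * ∑ l, if l < j then p (k' l) else 0) *
        (sgn (mpoSign p k' m) * (List.ofFn fun l => U (k' l) (m l)).prod.trace) =
      sgn ((∑ i, ∑ l, if l < i then (p (n i) + p (m i)) * p (n l) else 0) +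
          o * ∑ l, if l < j then p (n l) + p (m l) else 0) *
        (sgn (o * (p (k' j) + p (m j))) * (List.ofFn fun l =>
          (mconj Z ⊗ₖ Z) ^ (p (k' l) + p (m l)).val *
            (mconj (U (k l) (n l)) ⊗ₖ U (k' l) (m l))).prod.trace) := by
  have hg : ∀ l, (mconj Z ⊗ₖ Z) * (mconj (U (k l) (n l)) ⊗ₖ U (k' l) (m l)) =
      sgn (p (n l) + p (m l) + if l = j then o else 0) •
        ((mconj (U (k l) (n l)) ⊗ₖ U (k' l) (m l)) * (mconj Z ⊗ₖ Z)) := fun l => by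
    rw [graded_kronecker (graded_mconj (hU _ _)) (hU _ _), hk]
    congr 2
    linear_combination p (k' l) * (CharTwo.two_eq_zero : (2 : ZMod 2) = 0)
  rw [prod_ofFn_twist (kronecker_mconj_mul_self hZ) _ _ _ hg, kronecker_prod_ofFn,
    ← mconj_prod_ofFn, Matrix.trace_smul]
  by_cases h : ∑ l, (p (k' l) + p (m l)) = 0
  · have hs := congrArg sgn (sign_identity (fun l => p (k' l)) (fun l => p (n l))
      (fun l => p (m l)) j o h)
    simp only [← hk, ← mpoSign_eq_sum, sgn_add (_ + _), sgn_add (mpoSign _ _ _)] at hs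
    rw [h, ZMod.val_zero, pow_zero, one_mul, Matrix.trace_kronecker, trace_mconj, smul_eq_mul]
    linear_combination (star (List.ofFn fun l => U (k l) (n l)).prod.trace *
      (List.ofFn fun l => U (k' l) (m l)).prod.trace) * hs
  · have hg' := graded_prod_ofFn _ _ fun l => hU (k' l) (m l)
    rw [trace_eq_zero_of_graded hZ h hg', (eq_zero_or_eq_one _).resolve_left h, ZMod.val_one,
      pow_one, ← Matrix.mul_kronecker_mul, Matrix.trace_kronecker,
      trace_mul_eq_zero_of_graded h hg']
    simp

/-- Matrix elements of a conjugated local operator as traces of ordered products of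
double-layer bond matrices. -/
theorem conj_jordanWigner_apply {p : Fin d → ZMod 2} {Z : Matrix ν ν ℂ} (hZ : Z * Z = 1)
    {U : Fin d → Fin d → Matrix ν ν ℂ} (hU : ∀ n m, Z * U n m = sgn (p n + p m) • (U n m * Z))
    {o : ZMod 2} {O : Matrix (Fin d) (Fin d) ℂ} (hO : ∀ a b, p a + p b ≠ o → O a b = 0)
    (j : Fin N) (n m : Fin N → Fin d) :
    ((fMPO p U N)ᴴ * jordanWigner p o O j * fMPO p U N) n m =
      sgn ((∑ i, ∑ l, if l < i then (p (n i) + p (m i)) * p (n l) else 0) +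
          o * ∑ l, if l < j then p (n l) + p (m l) else 0) *
        (List.ofFn fun l => layer p Z U (if l = j then o else 0) (if l = j then O else 1)
          (n l) (m l)).prod.trace := by
  simp only [layer]
  rw [prod_ofFn_sum, Matrix.trace_sum, Finset.mul_sum,
    ← (Equiv.arrowProdEquivProdArrow (Fin N) (fun _ => Fin d) fun _ => Fin d).symm.sum_comp,
    Fintype.sum_prod_type_right, Matrix.mul_apply]
  refine Finset.sum_congr rfl fun k' _ => ?_
  rw [Matrix.mul_apply, Finset.sum_mul]
  refine Finset.sum_congr rfl fun k _ => ?_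
  simp only [Equiv.arrowProdEquivProdArrow, Equiv.coe_fn_symm_mk]
  rw [prod_ofFn_smul, Matrix.trace_smul, smul_eq_mul, Matrix.conjTranspose_apply,
    jordanWigner_apply]
  simp only [fMPO, Matrix.of_apply, star_mul', star_sgn]
  by_cases h : ∀ l, l ≠ j → k l = k' l
  · rw [if_pos h, Finset.prod_eq_single j (fun l _ hl => by
      simp only [if_neg hl, Matrix.one_apply, if_pos (h l hl), zero_mul, sgn_zero, one_mul])
      (by simp), if_pos rfl, if_pos rfl]
    by_cases hp : p (k j) + p (k' j) = o
    · have hk : ∀ l, p (k l) = p (k' l) + if l = j then o else 0 := fun l => by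
        split_ifs with hl
        · rw [hl, ← hp]
          linear_combination -p (k' j) * (CharTwo.two_eq_zero : (2 : ZMod 2) = 0)
        · rw [h l hl, add_zero]
      linear_combination O (k j) (k' j) * conj_entry_term hZ hU o j k k' n m hk
    · rw [hO _ _ hp]; simp
  · rw [if_neg h]
    push Not at h
    obtain ⟨l, hlj, hl⟩ := h
    rw [Finset.prod_eq_zero (Finset.mem_univ l) (by simp [hlj, Matrix.one_apply_ne hl])]
    simp

end Layers

section Absorption

variable {n ι : Type*} [Fintype n] [DecidableEq n]

/-- A word in the letters `a`, flanked by at least `K` letters on each side, may be replaced by a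
power of the letter `a e`, at the cost of the scalar assigned to the word by `χ`. -/
def Absorbs (a : ι → Matrix n n ℂ) (χ : ι → ℂ) (e : ι) (K : ℕ) : Prop :=
  ∀ u v w : List ι, K ≤ u.length → K ≤ v.length →
    ((u ++ w ++ v).map a).prod =
      (w.map χ).prod • ((u ++ List.replicate w.length e ++ v).map a).prod

theorem Absorbs.mono {a : ι → Matrix n n ℂ} {χ : ι → ℂ} {e : ι} {K L : ℕ}
    (h : Absorbs a χ e K) (hKL : K ≤ L) : Absorbs a χ e L :=
  fun u v w hu hv => h u v w (hKL.trans hu) (hKL.trans hv)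

theorem exists_absorbs (a : ι → Matrix n n ℂ) (χ : ι → ℂ)
    (htr : ∀ l : List ι, l ≠ [] → (l.map a).prod.trace = (l.map χ).prod) (e : ι) (he : χ e = 1) :
    ∃ K, Absorbs a χ e K := by
  obtain ⟨K, hK⟩ := exists_absorb_of_trace a χ htr e he
  refine ⟨K, fun u v w hu hv => ?_⟩
  have h := hK (u.drop (u.length - K)) (v.take K) w
    (by rw [List.length_drop]; omega) (by rw [List.length_take]; omega)
  have h' := congrArg (fun M => ((u.take (u.length - K)).map a).prod * M *
    ((v.drop K).map a).prod) h
  have hu' : (u.map a).prod =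
      ((u.take (u.length - K)).map a).prod * ((u.drop (u.length - K)).map a).prod := by
    rw [← List.prod_append, ← List.map_append, List.take_append_drop]
  have hv' : (v.map a).prod = ((v.take K).map a).prod * ((v.drop K).map a).prod := by
    rw [← List.prod_append, ← List.map_append, List.take_append_drop]
  simp only [List.map_append, List.prod_append, List.map_replicate, List.prod_replicate, hu', hv',
    mul_assoc, mul_smul_comm, smul_mul_assoc] at h' ⊢
  exact h'

theorem mul_prod_map_mul {R : Type*} [Ring R] {P : R} (hP : P * P = P) (a : ι → R)
    (hc : ∀ i, P * a i = a i * P) (l : List ι) :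
    P * (l.map fun i => P * a i).prod = P * (l.map a).prod := by
  induction l with
  | nil => simp
  | cons x l ih =>
    rw [List.map_cons, List.prod_cons, List.map_cons, List.prod_cons, ← mul_assoc, ← mul_assoc P P,
      hP, hc, mul_assoc, ih, ← mul_assoc, ← hc, mul_assoc]

theorem exists_mul_absorbs {P : Matrix n n ℂ} (hP : P * P = P) (a : ι → Matrix n n ℂ) (χ : ι → ℂ)
    (hc : ∀ i, P * a i = a i * P)
    (htr : ∀ l : List ι, l ≠ [] → (P * (l.map a).prod).trace = (l.map χ).prod)
    (e : ι) (he : χ e = 1) :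
    ∃ K, ∀ L, K ≤ L → ∀ u v w : List ι, L ≤ u.length → L ≤ v.length →
      P * ((u ++ w ++ v).map a).prod =
        (w.map χ).prod • (P * ((u ++ List.replicate w.length e ++ v).map a).prod) := by
  obtain ⟨K, hK⟩ := exists_absorbs (fun i => P * a i) χ (fun l hl => by
    rw [← htr l hl, ← mul_prod_map_mul hP a hc l]
    obtain ⟨x, l, rfl⟩ := List.exists_cons_of_ne_nil hl
    rw [List.map_cons, List.prod_cons, ← mul_assoc, ← mul_assoc P P, hP]) e he
  refine ⟨K, fun L hL u v w hu hv => ?_⟩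
  rw [← mul_prod_map_mul hP a hc, (hK.mono hL) u v w hu hv, mul_smul_comm,
    mul_prod_map_mul hP a hc]

/-- Absorption for a family commuting with an involution that splits it into two equal parts. -/
theorem exists_absorbs_of_involution (a : ι → Matrix n n ℂ) (χ : ι → ℂ) {T : Matrix n n ℂ}
    (hT : T * T = 1) (hTa : ∀ i, T * a i = a i * T)
    (htr : ∀ l : List ι, l ≠ [] → (l.map a).prod.trace = 2 * (l.map χ).prod)
    (htrT : ∀ l : List ι, (T * (l.map a).prod).trace = 0) (e : ι) (he : χ e = 1) :
    ∃ K, Absorbs a χ e K := by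
  have key : ∀ s : ℂ, s * s = 1 → ∃ K, ∀ L, K ≤ L → ∀ u v w : List ι, L ≤ u.length →
      L ≤ v.length → ((2⁻¹ : ℂ) • (1 + s • T)) * ((u ++ w ++ v).map a).prod =
        (w.map χ).prod • (((2⁻¹ : ℂ) • (1 + s • T)) *
          ((u ++ List.replicate w.length e ++ v).map a).prod) := fun s hs => by
    refine exists_mul_absorbs ?_ a χ (fun i => ?_) (fun l hl => ?_) e he
    · rw [smul_mul_smul_comm, mul_add, add_mul, add_mul, smul_mul_smul_comm, hs, hT]
      simp only [mul_one, one_mul, one_smul]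
      rw [show (1 + s • T + (s • T + 1) : Matrix n n ℂ) = (2 : ℂ) • (1 + s • T) by module,
        smul_smul]
      norm_num
    · simp only [smul_mul_assoc, mul_smul_comm, add_mul, mul_add, hTa, one_mul, mul_one]
    · rw [smul_mul_assoc, add_mul, smul_mul_assoc, one_mul, Matrix.trace_smul, Matrix.trace_add,
        Matrix.trace_smul, htr l hl, htrT l]
      simp
  obtain ⟨K, hK⟩ := key 1 (by norm_num)
  obtain ⟨K', hK'⟩ := key (-1) (by norm_num)
  refine ⟨max K K', fun u v w hu hv => ?_⟩
  have h := hK _ (le_max_left K K') u v w hu hv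
  have h' := hK' _ (le_max_right K K') u v w hu hv
  have hsum : ((2⁻¹ : ℂ) • (1 + (1 : ℂ) • T)) + ((2⁻¹ : ℂ) • (1 + (-1 : ℂ) • T)) = 1 := by
    module
  rw [← one_mul ((u ++ w ++ v).map a).prod, ← hsum, add_mul, h, h', ← smul_add, ← add_mul, hsum,
    one_mul]

end Absorption

section WordTraces

variable {d : ℕ} {ν : Type*} [Fintype ν] [DecidableEq ν]

/-- The double-layer tensor of an MPO, in the doubled physical index. -/
def bilayer (p : Fin d → ZMod 2) (Z : Matrix ν ν ℂ) (U : Fin d → Fin d → Matrix ν ν ℂ)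
    (x : Fin d × Fin d) : Matrix (ν × ν) (ν × ν) ℂ :=
  layer p Z U 0 1 x.1 x.2

/-- The indicator of the diagonal in the doubled physical index. -/
def diagInd (x : Fin d × Fin d) : ℂ := if x.1 = x.2 then 1 else 0

theorem trace_prod_bilayer {p : Fin d → ZMod 2} {Z : Matrix ν ν ℂ} (hZ : Z * Z = 1)
    {U : Fin d → Fin d → Matrix ν ν ℂ} (hU : ∀ n m, Z * U n m = sgn (p n + p m) • (U n m * Z))
    {c τ : ℂ} (hc : τ * (star c * c) = 1)
    (hunit : ∀ N : ℕ, 1 ≤ N → c • fMPO p U N ∈ Matrix.unitaryGroup (Fin N → Fin d) ℂ)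
    (l : List (Fin d × Fin d)) (hl : l ≠ []) :
    (l.map (bilayer p Z U)).prod.trace = τ * (l.map diagInd).prod := by
  have hN : 1 ≤ l.length := List.length_pos_iff.2 hl
  have h1 := conj_jordanWigner_apply (o := 0) (O := 1) hZ hU
    (fun a b hab => Matrix.one_apply_ne fun h => hab (by rw [h, CharTwo.add_self_eq_zero]))
    (⟨0, hN⟩ : Fin l.length) (fun i => (l.get i).1) (fun i => (l.get i).2)
  have h2 := congrFun (congrFun (Matrix.mem_unitaryGroup_iff'.1 (hunit _ hN))
    (fun i => (l.get i).1)) (fun i => (l.get i).2)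
  rw [Matrix.star_eq_conjTranspose, Matrix.conjTranspose_smul, smul_mul_smul_comm,
    Matrix.smul_apply, smul_eq_mul] at h2
  rw [jordanWigner_zero_one, mul_one] at h1
  rw [h1] at h2
  simp only [ite_self, zero_mul, add_zero] at h2
  have h3 : (List.ofFn fun i : Fin l.length => layer p Z U 0 1 (l.get i).1 (l.get i).2) =
      l.map (bilayer p Z U) := by
    conv_rhs => rw [← List.ofFn_get l, List.map_ofFn]
    rfl
  have h4 : (l.map diagInd).prod = ∏ i : Fin l.length, diagInd (l.get i) := by
    conv_lhs => rw [← List.ofFn_get l, List.map_ofFn, List.prod_ofFn]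
    rfl
  rw [h3] at h2
  rw [h4]
  by_cases hnm : (fun i => (l.get i).1) = fun i => (l.get i).2
  · rw [Finset.prod_eq_one fun i _ => show diagInd (l.get i) = 1 from if_pos (congrFun hnm i)]
    rw [hnm, Matrix.one_apply_eq] at h2
    simp only [show ∀ i, (l.get i).1 = (l.get i).2 from congrFun hnm, CharTwo.add_self_eq_zero,
      zero_mul, ite_self, Finset.sum_const_zero, sgn_zero,
      one_mul] at h2
    linear_combination τ * h2 - (l.map (bilayer p Z U)).prod.trace * hc
  · rw [Matrix.one_apply_ne hnm] at h2
    have hcc : star c * c ≠ 0 := right_ne_zero_of_mul_eq_one hc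
    obtain ⟨i, hi⟩ := Function.ne_iff.1 hnm
    rw [Finset.prod_eq_zero (Finset.mem_univ i) (show diagInd (l.get i) = 0 from if_neg hi),
      mul_zero]
    exact (mul_eq_zero.1 ((mul_eq_zero.1 h2).resolve_left hcc)).resolve_left (sgn_ne_zero _)

theorem graded_prod_map {R ι : Type*} [Ring R] [Algebra ℂ R] {Y : R} {a : ι → R} {q : ι → ZMod 2}
    (h : ∀ i, Y * a i = sgn (q i) • (a i * Y)) (l : List ι) :
    Y * (l.map a).prod = sgn (l.map q).sum • ((l.map a).prod * Y) := by
  induction l with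
  | nil => simp [sgn_zero]
  | cons x l ih =>
    rw [List.map_cons, List.prod_cons, List.map_cons, List.sum_cons]
    exact graded_mul (h x) ih

theorem graded_layer {p : Fin d → ZMod 2} {Z : Matrix ν ν ℂ}
    {U : Fin d → Fin d → Matrix ν ν ℂ} (hU : ∀ n m, Z * U n m = sgn (p n + p m) • (U n m * Z))
    {o : ZMod 2} {O : Matrix (Fin d) (Fin d) ℂ} (hO : ∀ a b, p a + p b ≠ o → O a b = 0)
    (n m : Fin d) :
    (mconj Z ⊗ₖ Z) * layer p Z U o O n m =
      sgn (p n + p m + o) • (layer p Z U o O n m * (mconj Z ⊗ₖ Z)) := by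
  rw [layer, Finset.mul_sum, Finset.sum_mul, Finset.smul_sum]
  refine Finset.sum_congr rfl fun k _ => ?_
  by_cases hk : p k.1 + p k.2 = o
  · have h := graded_kronecker (graded_mconj (hU k.1 n)) (hU k.2 m)
    have hY : (mconj Z ⊗ₖ Z) * (mconj Z ⊗ₖ Z) ^ (p k.2 + p m).val =
        (mconj Z ⊗ₖ Z) ^ (p k.2 + p m).val * (mconj Z ⊗ₖ Z) := (Commute.self_pow _ _).eq
    rw [mul_smul_comm, ← mul_assoc, hY, mul_assoc, h, mul_smul_comm, smul_mul_assoc, smul_comm,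
      mul_assoc, show p k.1 + p n + (p k.2 + p m) = p n + p m + o by rw [← hk]; ring]
  · simp [hO _ _ hk]

theorem bilayer_eq (p : Fin d → ZMod 2) (Z : Matrix ν ν ℂ) (U : Fin d → Fin d → Matrix ν ν ℂ)
    (x : Fin d × Fin d) :
    bilayer p Z U x = ∑ k, (mconj Z ⊗ₖ Z) ^ (p k + p x.2).val * (mconj (U k x.1) ⊗ₖ U k x.2) := by
  rw [bilayer, layer, Fintype.sum_prod_type]
  refine Finset.sum_congr rfl fun k _ => ?_
  rw [Finset.sum_eq_single k (fun k' _ hk => by simp [Matrix.one_apply_ne hk.symm]) (by simp)]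
  simp [sgn_zero]

/-- An odd involution on the bonds commuting with the tensor forces the double-layer words to
split into two equal parts. -/
theorem exists_involution_of_odd_symmetry {p : Fin d → ZMod 2} {Z : Matrix ν ν ℂ}
    (hZ : Z * Z = 1) {U : Fin d → Fin d → Matrix ν ν ℂ}
    (hU : ∀ n m, Z * U n m = sgn (p n + p m) • (U n m * Z)) {S : Matrix ν ν ℂ} (hS : S * S = 1)
    (hZS : Z * S = -(S * Z)) (hSU : ∀ n m, S * U n m = U n m * S) :
    ∃ T : Matrix (ν × ν) (ν × ν) ℂ, T * T = 1 ∧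
      (∀ x, T * bilayer p Z U x = bilayer p Z U x * T) ∧
      ∀ l : List (Fin d × Fin d), (T * (l.map (bilayer p Z U)).prod).trace = 0 := by
  have hneg : ∀ A : Matrix ν ν ℂ, mconj (-A) = -mconj A := fun A => by ext; simp [mconj]
  have hYY := kronecker_mconj_mul_self hZ
  have hTY : Commute (mconj S ⊗ₖ S) (mconj Z ⊗ₖ Z) := by
    rw [Commute, SemiconjBy, ← Matrix.mul_kronecker_mul, ← mconj_mul, ← Matrix.mul_kronecker_mul,
      ← mconj_mul, hZS, hneg]
    ext; simp
  have hTW : ∀ x, (mconj S ⊗ₖ S) * bilayer p Z U x = bilayer p Z U x * (mconj S ⊗ₖ S) := by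
    intro x
    rw [bilayer_eq, Finset.mul_sum, Finset.sum_mul]
    refine Finset.sum_congr rfl fun k _ => ?_
    refine ((hTY.pow_right _).mul_right ?_).eq
    rw [Commute, SemiconjBy, ← Matrix.mul_kronecker_mul, ← mconj_mul, ← Matrix.mul_kronecker_mul,
      ← mconj_mul, hSU, hSU]
  have hQY : (mconj (Z * S) ⊗ₖ (1 : Matrix ν ν ℂ)) * (mconj Z ⊗ₖ Z) =
      sgn 1 • ((mconj Z ⊗ₖ Z) * (mconj (Z * S) ⊗ₖ (1 : Matrix ν ν ℂ))) := by
    rw [← Matrix.mul_kronecker_mul, ← mconj_mul, ← Matrix.mul_kronecker_mul, ← mconj_mul,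
      mul_assoc, ← neg_neg (S * Z), ← hZS, mul_neg, hneg, one_mul, mul_one, sgn_one]
    ext; simp
  have hQU : ∀ k n m, (mconj (Z * S) ⊗ₖ (1 : Matrix ν ν ℂ)) * (mconj (U k n) ⊗ₖ U k m) =
      sgn (p k + p n) • ((mconj (U k n) ⊗ₖ U k m) * (mconj (Z * S) ⊗ₖ (1 : Matrix ν ν ℂ))) := by
    intro k n m
    rw [← Matrix.mul_kronecker_mul, ← mconj_mul, ← Matrix.mul_kronecker_mul, ← mconj_mul,
      mul_assoc, hSU, ← mul_assoc, hU, smul_mul_assoc, mconj_smul, star_sgn,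
      Matrix.smul_kronecker, one_mul, mul_one, mul_assoc]
  have hQW : ∀ x, (mconj (Z * S) ⊗ₖ (1 : Matrix ν ν ℂ)) * bilayer p Z U x =
      sgn (p x.1 + p x.2) •
        (bilayer p Z U x * (mconj (Z * S) ⊗ₖ (1 : Matrix ν ν ℂ))) := by
    intro x
    rw [bilayer_eq, Finset.mul_sum, Finset.sum_mul, Finset.smul_sum]
    refine Finset.sum_congr rfl fun k _ => ?_
    have hpow : ∀ b : ZMod 2, (mconj (Z * S) ⊗ₖ (1 : Matrix ν ν ℂ)) * (mconj Z ⊗ₖ Z) ^ b.val =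
        sgn b • ((mconj Z ⊗ₖ Z) ^ b.val * (mconj (Z * S) ⊗ₖ (1 : Matrix ν ν ℂ))) := fun b => by
      obtain rfl | rfl := eq_zero_or_eq_one b
      · simp [sgn_zero]
      · simpa [ZMod.val_one] using hQY
    rw [graded_mul (hpow _) (hQU k x.1 x.2)]
    congr 2
    linear_combination p k * (CharTwo.two_eq_zero : (2 : ZMod 2) = 0)
  have hYW : ∀ x, (mconj Z ⊗ₖ Z) * bilayer p Z U x =
      sgn (p x.1 + p x.2) • (bilayer p Z U x * (mconj Z ⊗ₖ Z)) := fun x => by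
    rw [bilayer, graded_layer hU
      (fun a b hab => Matrix.one_apply_ne fun h => hab (by rw [h, CharTwo.add_self_eq_zero])),
      add_zero]
  refine ⟨mconj S ⊗ₖ S, kronecker_mconj_mul_self hS, hTW, fun l => ?_⟩
  by_cases hl : (l.map fun x => p x.1 + p x.2).sum = 0
  · have hw := graded_prod_map hQW l
    rw [hl, sgn_zero, one_smul] at hw
    have hQT : (mconj (Z * S) ⊗ₖ (1 : Matrix ν ν ℂ)) * (mconj S ⊗ₖ S) =
        sgn 1 • ((mconj S ⊗ₖ S) * (mconj (Z * S) ⊗ₖ (1 : Matrix ν ν ℂ))) := by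
      rw [← Matrix.mul_kronecker_mul, ← mconj_mul, ← Matrix.mul_kronecker_mul, ← mconj_mul,
        hZS, mul_neg, ← mul_assoc S S, hS, neg_mul, mul_assoc, hZS, mul_neg, neg_neg, ← mul_assoc,
        hS, hneg, sgn_one, one_mul, mul_one]
      ext; simp
    have hQQ : (mconj (Z * S) ⊗ₖ (1 : Matrix ν ν ℂ)) * (mconj (Z * S) ⊗ₖ (1 : Matrix ν ν ℂ)) =
        -1 := by
      rw [← Matrix.mul_kronecker_mul, ← mconj_mul, mul_assoc, ← mul_assoc S Z, ← neg_neg (S * Z),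
        ← hZS, neg_mul, mul_neg, mul_assoc, hS, mul_one, hZ, hneg, mconj_one, one_mul]
      ext ⟨i, j⟩ ⟨i', j'⟩
      by_cases hi : i = i' <;> by_cases hj : j = j' <;> simp [hi, hj]
    have h := graded_mul (B := (l.map (bilayer p Z U)).prod) (s := 0) hQT
      (by rw [sgn_zero, one_smul, hw])
    have h2 := congrArg (fun M => ((mconj (Z * S) ⊗ₖ (1 : Matrix ν ν ℂ)) * M).trace) h
    simp only [mul_smul_comm, Matrix.trace_smul] at h2
    rw [← mul_assoc, hQQ, Matrix.trace_mul_comm _ (_ * _ * _), mul_assoc _ _ (mconj (Z * S) ⊗ₖ _),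
      hQQ, add_zero, sgn_one] at h2
    simp only [neg_mul, one_mul, mul_neg, mul_one, Matrix.trace_neg, smul_eq_mul, neg_neg] at h2
    linear_combination -h2 / 2
  · refine trace_eq_zero_of_graded (q := 0 + (l.map fun x => p x.1 + p x.2).sum) hYY
      (by rwa [zero_add]) (graded_mul ?_ (graded_prod_map hYW l))
    rw [sgn_zero, one_smul, hTY.eq]

end WordTraces

section Window

variable {n ι : Type*} [Fintype n] [DecidableEq n] {N : ℕ}

theorem ofFn_ite_eq {R : Type*} (a : ι → R) (B : R) (x : Fin N → ι) (j : Fin N) :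
    (List.ofFn fun l => if l = j then B else a (x l)) =
      ((List.ofFn x).take j).map a ++ B :: ((List.ofFn x).drop (j + 1)).map a := by
  have hj := j.isLt
  refine List.ext_getElem (by simp; omega) fun i h1 h2 => ?_
  rcases lt_trichotomy i (j : ℕ) with h | h | h
  · rw [List.getElem_append_left (by simp; omega)]
    simp [Fin.ext_iff, h.ne]
  · rw [List.getElem_append_right (by simp; omega)]
    simp [Fin.ext_iff, h]
  · rw [List.getElem_append_right (by simp; omega), List.getElem_cons]
    have hi : ¬ i - (j : ℕ) = 0 := by omega
    have hi' : (j : ℕ) + 1 + (i - (j : ℕ) - 1) = i := by omega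
    simp [Fin.ext_iff, h.ne', hi, hi']

/-- A trace of an ordered product with a marked site, reordered around that site: the letters far
from the marked site can be absorbed. -/
theorem trace_ofFn_ite_eq {a : ι → Matrix n n ℂ} {χ : ι → ℂ} {e : ι} {r : ℕ}
    (h : Absorbs a χ e r) (B : Matrix n n ℂ) (x : Fin N → ι) (j : Fin N) (hjl : r ≤ (j : ℕ))
    (hjr : (j : ℕ) + r < N) :
    (List.ofFn fun l => if l = j then B else a (x l)).prod.trace =
      (((List.ofFn x).drop (j + 1 + r) ++ (List.ofFn x).take (j - r)).map χ).prod *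
        (B * ((((List.ofFn x).drop (j + 1)).take r ++
          List.replicate ((List.ofFn x).drop (j + 1 + r) ++ (List.ofFn x).take (j - r)).length e ++
            ((List.ofFn x).take j).drop (j - r)).map a).prod).trace := by
  have h1 := h (((List.ofFn x).drop (j + 1)).take r) (((List.ofFn x).take j).drop (j - r))
    ((List.ofFn x).drop (j + 1 + r) ++ (List.ofFn x).take (j - r))
    (by simp; omega) (by simp; omega)
  rw [← smul_eq_mul, ← Matrix.trace_smul, ← mul_smul_comm, ← h1, ofFn_ite_eq, List.prod_append,
    List.prod_cons, Matrix.trace_mul_comm, mul_assoc, ← List.prod_append, ← List.map_append]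
  congr 4
  have h2 : (List.ofFn x).take (j - r) = ((List.ofFn x).take j).take (j - r) := by
    rw [List.take_take, min_eq_left (Nat.sub_le _ _)]
  rw [h2, ← List.drop_drop (i := r), ← List.append_assoc (List.take r _), List.take_append_drop,
    List.append_assoc, List.take_append_drop]

theorem trace_ofFn_eq_zero_of_absorbs {a : ι → Matrix n n ℂ} {χ : ι → ℂ} {e : ι} {r : ℕ}
    (h : Absorbs a χ e r) (B : Matrix n n ℂ) (x : Fin N → ι) (j : Fin N) (hjl : r ≤ (j : ℕ))
    (hjr : (j : ℕ) + r < N) {l : Fin N} (hl : (l : ℕ) + r < j ∨ (j : ℕ) + r < l)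
    (hx : χ (x l) = 0) :
    (List.ofFn fun l => if l = j then B else a (x l)).prod.trace = 0 := by
  rw [trace_ofFn_ite_eq h B x j hjl hjr, List.prod_eq_zero, zero_mul]
  rw [← hx]
  refine List.mem_map_of_mem (List.mem_append.2 ?_)
  have hlN := l.isLt
  rcases hl with hl | hl
  · exact Or.inr (List.mem_iff_getElem.2 ⟨l, by simp; omega, by simp⟩)
  · refine Or.inl (List.mem_iff_getElem.2 ⟨l - (j + 1 + r), by simp; omega, ?_⟩)
    have : (j : ℕ) + 1 + r + (l - (j + 1 + r)) = l := by omega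
    simp [this]

theorem trace_ofFn_eq_of_absorbs {a : ι → Matrix n n ℂ} {χ : ι → ℂ} {e : ι} {r : ℕ}
    (h : Absorbs a χ e r) (B : Matrix n n ℂ) (x y : Fin N → ι) (j : Fin N) (hjl : r ≤ (j : ℕ))
    (hjr : (j : ℕ) + r < N)
    (hx : ∀ l : Fin N, (l : ℕ) + r < j ∨ (j : ℕ) + r < l → χ (x l) = 1)
    (hy : ∀ l : Fin N, (l : ℕ) + r < j ∨ (j : ℕ) + r < l → χ (y l) = 1)
    (hxy : ∀ l : Fin N, ¬ ((l : ℕ) + r < j ∨ (j : ℕ) + r < l) → x l = y l) :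
    (List.ofFn fun l => if l = j then B else a (x l)).prod.trace =
      (List.ofFn fun l => if l = j then B else a (y l)).prod.trace := by
  have hone : ∀ z : Fin N → ι,
      (∀ l : Fin N, (l : ℕ) + r < j ∨ (j : ℕ) + r < l → χ (z l) = 1) →
      (((List.ofFn z).drop (j + 1 + r) ++ (List.ofFn z).take (j - r)).map χ).prod = 1 := by
    intro z hz
    refine List.prod_eq_one fun t ht => ?_
    obtain ⟨s, hs, rfl⟩ := List.mem_map.1 ht
    rcases List.mem_append.1 hs with hs | hs
    · obtain ⟨i, hi, rfl⟩ := List.mem_iff_getElem.1 hs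
      rw [List.getElem_drop, List.getElem_ofFn]
      exact hz _ (Or.inr (by simp only; omega))
    · obtain ⟨i, hi, rfl⟩ := List.mem_iff_getElem.1 hs
      rw [List.getElem_take, List.getElem_ofFn]
      rw [List.length_take] at hi
      exact hz _ (Or.inl (by simp only; omega))
  rw [trace_ofFn_ite_eq h B x j hjl hjr, trace_ofFn_ite_eq h B y j hjl hjr, hone x hx, hone y hy]
  have hu : ((List.ofFn x).drop (j + 1)).take r = ((List.ofFn y).drop (j + 1)).take r := by
    refine List.ext_getElem (by simp) fun i h1 h2 => ?_
    simp only [List.length_take] at h1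
    simp only [List.getElem_take, List.getElem_drop, List.getElem_ofFn]
    exact hxy _ (by simp only; omega)
  have hv : ((List.ofFn x).take j).drop (j - r) = ((List.ofFn y).take j).drop (j - r) := by
    refine List.ext_getElem (by simp) fun i h1 h2 => ?_
    simp only [List.length_take, List.length_drop] at h1
    simp only [List.getElem_take, List.getElem_drop, List.getElem_ofFn]
    exact hxy _ (by simp only; omega)
  rw [hu, hv]
  simp only [List.length_append, List.length_drop, List.length_take, List.length_ofFn]

/-- Sites away from the window enter the fermionic sign only through the parity string. -/
theorem window_sign {y z y' z' : Fin N → ZMod 2} {j : Fin N} {r : ℕ} {o : ZMod 2}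
    (hyz : ∀ l : Fin N, (l : ℕ) + r < j ∨ (j : ℕ) + r < l → y l = z l)
    (hyz' : ∀ l : Fin N, (l : ℕ) + r < j ∨ (j : ℕ) + r < l → y' l = z' l)
    (hy : ∀ l : Fin N, ¬ ((l : ℕ) + r < j ∨ (j : ℕ) + r < l) → y l = y' l)
    (hz : ∀ l : Fin N, ¬ ((l : ℕ) + r < j ∨ (j : ℕ) + r < l) → z l = z' l)
    (ho : ∑ l, (y l + z l) = o) :
    ((∑ i, ∑ l, if l < i then (y i + z i) * y l else 0) +
        o * ∑ l, if l < j then y l + z l else 0) +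
        o * (∑ l : Fin N, if (l : ℕ) + r < j then y l else 0) =
      ((∑ i, ∑ l, if l < i then (y' i + z' i) * y' l else 0) +
        o * ∑ l, if l < j then y' l + z' l else 0) +
        o * (∑ l : Fin N, if (l : ℕ) + r < j then y' l else 0) := by
  have hd : ∀ i, y' i + z' i = y i + z i := fun i => by
    by_cases hi : (i : ℕ) + r < j ∨ (j : ℕ) + r < i
    · rw [hyz i hi, hyz' i hi, CharTwo.add_self_eq_zero, CharTwo.add_self_eq_zero]
    · rw [hy i hi, hz i hi]
  have h0 : ∀ i : Fin N, (i : ℕ) + r < j ∨ (j : ℕ) + r < i → y i + z i = 0 := fun i hi => by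
    rw [hyz i hi, CharTwo.add_self_eq_zero]
  have key : ∀ f : Fin N → ZMod 2,
      (∑ i : Fin N, ∑ l : Fin N, if l < i then (y i + z i) * f l else 0) +
        o * (∑ l : Fin N, if (l : ℕ) + r < j then f l else 0) =
      ∑ l : Fin N, if (l : ℕ) + r < j ∨ (j : ℕ) + r < l then 0 else
        (∑ i : Fin N, if l < i then y i + z i else 0) * f l := by
    intro f
    rw [Finset.sum_comm, Finset.mul_sum, ← Finset.sum_add_distrib]
    refine Finset.sum_congr rfl fun l _ => ?_
    have hs : (∑ i, if l < i then (y i + z i) * f l else 0) =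
        (∑ i, if l < i then y i + z i else 0) * f l := by
      rw [Finset.sum_mul]
      exact Finset.sum_congr rfl fun i _ => by split_ifs <;> simp
    rw [hs]
    by_cases hl : (l : ℕ) + r < j
    · have : (∑ i, if l < i then y i + z i else 0) = o := by
        rw [← ho]
        refine Finset.sum_congr rfl fun i _ => ?_
        split_ifs with hi
        · rfl
        · rw [h0 i (Or.inl (by rw [not_lt, Fin.le_def] at hi; omega))]
      rw [this, if_pos hl, if_pos (Or.inl hl), CharTwo.add_self_eq_zero]
    · by_cases hl' : (j : ℕ) + r < l
      · rw [if_neg hl, if_pos (Or.inr hl'), mul_zero, add_zero, Finset.sum_eq_zero, zero_mul]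
        intro i _
        split_ifs with hi
        · exact h0 i (Or.inr (hl'.trans hi))
        · rfl
      · rw [if_neg hl, if_neg (not_or.2 ⟨hl, hl'⟩), mul_zero, add_zero]
  have h := (key y).trans (Eq.trans ?_ (key y').symm)
  · simp only [hd]
    linear_combination h
  · refine Finset.sum_congr rfl fun l _ => ?_
    split_ifs with hl
    · rfl
    · rw [hy l hl]

end Window

section Locality

variable {d N : ℕ} {ν : Type*} [Fintype ν] [DecidableEq ν]

/-- Extension of a configuration on the window of radius `r` around `j` by the reference
state `e` outside. -/
def extend (e : Fin d) (j : Fin N) (r : ℕ) (a : Fin (2 * r + 1) → Fin d) (l : Fin N) : Fin d :=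
  if h : (l : ℕ) + r < j ∨ (j : ℕ) + r < l then e else a ⟨l + r - j, by omega⟩

theorem extend_of_outside {e : Fin d} {j : Fin N} {r : ℕ} {a : Fin (2 * r + 1) → Fin d}
    {l : Fin N} (h : (l : ℕ) + r < j ∨ (j : ℕ) + r < l) : extend e j r a l = e :=
  dif_pos h

theorem extend_window {e : Fin d} {j : Fin N} {r : ℕ} (hjl : r ≤ (j : ℕ))
    (hjr : (j : ℕ) + r < N) (a : Fin (2 * r + 1) → Fin d) (t : Fin (2 * r + 1)) :
    extend e j r a ⟨(j : ℕ) - r + t, by have := t.isLt; omega⟩ = a t := by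
  have := t.isLt
  rw [extend, dif_neg (by simp only; omega)]
  congr 1
  ext
  simp only
  omega

theorem extend_restrict {e : Fin d} {j : Fin N} {r : ℕ} (hjl : r ≤ (j : ℕ))
    (hjr : (j : ℕ) + r < N) (n : Fin N → Fin d) {l : Fin N}
    (h : ¬ ((l : ℕ) + r < j ∨ (j : ℕ) + r < l)) :
    extend e j r (fun t => n ⟨(j : ℕ) - r + t, by have := t.isLt; omega⟩) l = n l := by
  rw [extend, dif_neg h]
  congr 1
  ext
  simp only
  omega

theorem trace_layers_eq_zero {p : Fin d → ZMod 2} {Z : Matrix ν ν ℂ} (hZ : Z * Z = 1)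
    {U : Fin d → Fin d → Matrix ν ν ℂ} (hU : ∀ n m, Z * U n m = sgn (p n + p m) • (U n m * Z))
    {o : ZMod 2} {O : Matrix (Fin d) (Fin d) ℂ} (hO : ∀ a b, p a + p b ≠ o → O a b = 0)
    (j : Fin N) (n m : Fin N → Fin d) (h : ∑ l, (p (n l) + p (m l)) ≠ o) :
    (List.ofFn fun l => if l = j then layer p Z U o O (n j) (m j) else
      bilayer p Z U (n l, m l)).prod.trace = 0 := by
  refine trace_eq_zero_of_graded (kronecker_mconj_mul_self hZ)
    (q := ∑ l, (p (n l) + p (m l) + if l = j then o else 0)) ?_ (graded_prod_ofFn _ _ fun l => ?_)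
  · rw [Finset.sum_add_distrib, Finset.sum_ite_eq' Finset.univ j, if_pos (Finset.mem_univ j)]
    exact fun h' => h (CharTwo.add_eq_zero.1 h')
  · split_ifs with hl
    · rw [hl]
      exact graded_layer hU hO _ _
    · exact graded_layer hU
        (fun a b hab => Matrix.one_apply_ne fun h => hab (by rw [h, CharTwo.add_self_eq_zero])) _ _

theorem exists_local_conj {p : Fin d → ZMod 2} {Z : Matrix ν ν ℂ} (hZ : Z * Z = 1)
    {U : Fin d → Fin d → Matrix ν ν ℂ} (hU : ∀ n m, Z * U n m = sgn (p n + p m) • (U n m * Z))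
    {e : Fin d} {r : ℕ} (hr : Absorbs (bilayer p Z U) diagInd (e, e) r) (c : ℂ)
    (j : Fin N) (hjl : r ≤ (j : ℕ)) (hjr : (j : ℕ) + r < N) {o : ZMod 2}
    {O : Matrix (Fin d) (Fin d) ℂ} (hO : ∀ a b, p a + p b ≠ o → O a b = 0) :
    ∃ Ot : Matrix (Fin (2 * r + 1) → Fin d) (Fin (2 * r + 1) → Fin d) ℂ,
      bigP p (2 * r + 1) * Ot * bigP p (2 * r + 1) = sgn o • Ot ∧
      ∀ n m : Fin N → Fin d,
        ((c • fMPO p U N)ᴴ * jordanWigner p o O j * (c • fMPO p U N)) n m =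
          (∏ l ∈ Finset.univ.filter (fun l : Fin N => (l : ℕ) + r < (j : ℕ)),
            ((singleP p) ^ o.val) (n l) (m l)) *
          Ot (fun t => n ⟨(j : ℕ) - r + (t : ℕ), by have := t.isLt; omega⟩)
             (fun t => m ⟨(j : ℕ) - r + (t : ℕ), by have := t.isLt; omega⟩) *
          (∏ l ∈ Finset.univ.filter (fun l : Fin N => (j : ℕ) + r < (l : ℕ)),
            (if n l = m l then (1 : ℂ) else 0)) := by
  let F : (Fin N → Fin d) → (Fin N → Fin d) → ℂ := fun n m =>
    (List.ofFn fun l => if l = j then layer p Z U o O (n j) (m j) else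
      bilayer p Z U (n l, m l)).prod.trace
  let σ : (Fin N → Fin d) → (Fin N → Fin d) → ZMod 2 := fun n m =>
    (∑ i, ∑ l, if l < i then (p (n i) + p (m i)) * p (n l) else 0) +
      o * ∑ l, if l < j then p (n l) + p (m l) else 0
  let τ : (Fin N → Fin d) → ZMod 2 := fun n =>
    o * ∑ l : Fin N, if (l : ℕ) + r < j then p (n l) else 0
  have hF0 : ∀ n m, ∑ l, (p (n l) + p (m l)) ≠ o → F n m = 0 :=
    trace_layers_eq_zero hZ hU hO j
  have hentry : ∀ n m, ((c • fMPO p U N)ᴴ * jordanWigner p o O j * (c • fMPO p U N)) n m =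
      star c * c * (sgn (σ n m) * F n m) := fun n m => by
    rw [Matrix.conjTranspose_smul, smul_mul_assoc, smul_mul_smul_comm, Matrix.smul_apply,
      conj_jordanWigner_apply hZ hU hO, smul_eq_mul]
    simp only [σ, F]
    congr 5
    funext l
    split_ifs with hl
    · rw [hl]
    · rfl
  refine ⟨Matrix.of fun a b => star c * c * (sgn (σ (extend e j r a) (extend e j r b) +
    τ (extend e j r a)) * F (extend e j r a) (extend e j r b)), ?_, fun n m => ?_⟩
  · ext a b
    rw [bigP, Matrix.mul_diagonal, Matrix.diagonal_mul, Matrix.smul_apply, smul_eq_mul,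
      Matrix.of_apply]
    have hsum : ∑ t, (p (a t) + p (b t)) =
        ∑ l, (p (extend e j r a l) + p (extend e j r b l)) := by
      refine Fintype.sum_of_injective
        (fun t : Fin (2 * r + 1) => (⟨(j : ℕ) - r + t, by have := t.isLt; omega⟩ : Fin N))
        (fun s t hst => ?_) _ _ (fun l hl => ?_) fun t => ?_
      · simp only [Fin.mk.injEq] at hst
        ext
        omega
      · have hout : (l : ℕ) + r < j ∨ (j : ℕ) + r < l := by
          by_contra hin
          refine hl ⟨⟨l + r - j, by omega⟩, ?_⟩
          ext
          simp only
          omega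
        rw [extend_of_outside hout, extend_of_outside hout, CharTwo.add_self_eq_zero]
      · rw [extend_window hjl hjr, extend_window hjl hjr]
    by_cases hab : ∑ t, (p (a t) + p (b t)) = o
    · have hs := congrArg sgn hab
      rw [Finset.sum_add_distrib, sgn_add] at hs
      rw [← hs]
      ring
    · rw [hF0 _ _ (hsum ▸ hab)]
      simp
  · rw [hentry, Matrix.of_apply]
    set n' := extend e j r fun t => n ⟨(j : ℕ) - r + t, by have := t.isLt; omega⟩ with hn'
    set m' := extend e j r fun t => m ⟨(j : ℕ) - r + t, by have := t.isLt; omega⟩ with hm'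
    by_cases hout : ∀ l : Fin N, (l : ℕ) + r < j ∨ (j : ℕ) + r < l → n l = m l
    · have hnn' : ∀ l : Fin N, ¬ ((l : ℕ) + r < j ∨ (j : ℕ) + r < l) → n l = n' l :=
        fun l hl => (extend_restrict hjl hjr n hl).symm
      have hmm' : ∀ l : Fin N, ¬ ((l : ℕ) + r < j ∨ (j : ℕ) + r < l) → m l = m' l :=
        fun l hl => (extend_restrict hjl hjr m hl).symm
      have hnm' : ∀ l : Fin N, (l : ℕ) + r < j ∨ (j : ℕ) + r < l → n' l = m' l :=
        fun l hl => (extend_of_outside hl).trans (extend_of_outside hl).symm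
      have hj : ¬ ((j : ℕ) + r < j ∨ (j : ℕ) + r < j) := by omega
      have hF : F n m = F n' m' := by
        simp only [F]
        rw [← hnn' j hj, ← hmm' j hj]
        exact trace_ofFn_eq_of_absorbs hr _ (fun l => (n l, m l)) (fun l => (n' l, m' l)) j hjl hjr
          (fun l hl => if_pos (hout l hl)) (fun l hl => if_pos (hnm' l hl))
          fun l hl => Prod.ext (hnn' l hl) (hmm' l hl)
      have hleft : (∏ l ∈ Finset.univ.filter (fun l : Fin N => (l : ℕ) + r < (j : ℕ)),
          ((singleP p) ^ o.val) (n l) (m l)) = sgn (τ n) := by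
        simp only [τ]
        rw [← Finset.sum_filter, Finset.mul_sum, sgn_sum]
        refine Finset.prod_congr rfl fun l hl => ?_
        rw [singleP_pow_apply, if_pos (hout l (Or.inl (Finset.mem_filter.1 hl).2))]
      rw [hleft, Finset.prod_eq_one fun l hl =>
        if_pos (hout l (Or.inr (Finset.mem_filter.1 hl).2)), mul_one, ← hF]
      by_cases ho : ∑ l, (p (n l) + p (m l)) = o
      · have hs : σ n m + τ n = σ n' m' + τ n' :=
          window_sign (fun l hl => congrArg p (hout l hl)) (fun l hl => congrArg p (hnm' l hl))
            (fun l hl => congrArg p (hnn' l hl)) (fun l hl => congrArg p (hmm' l hl)) ho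
        rw [← hs, sgn_add (σ n m) (τ n)]
        linear_combination -(star c * c * sgn (σ n m) * F n m) * sgn_mul_self (τ n)
      · rw [hF0 n m ho]
        simp
    · push Not at hout
      obtain ⟨l, hl, hnl⟩ := hout
      have hF : F n m = 0 := trace_ofFn_eq_zero_of_absorbs hr _ (fun l => (n l, m l)) j hjl hjr hl
        (if_neg hnl)
      rw [hF, mul_zero, mul_zero, eq_comm, mul_eq_zero, mul_eq_zero]
      rcases hl with hl | hl
      · exact Or.inl (Or.inl (Finset.prod_eq_zero (i := l) (by simpa using hl)
          (by rw [singleP_pow_apply, if_neg hnl])))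
      · exact Or.inr (Finset.prod_eq_zero (i := l) (by simpa using hl) (if_neg hnl))

end Locality

theorem IsParityMatrix.mul_self {ν : Type*} [Fintype ν] [DecidableEq ν] {Z : Matrix ν ν ℂ}
    (hZ : IsParityMatrix Z) : Z * Z = 1 := by
  rw [← hZ.1.diagonal_diag, Matrix.diagonal_mul_diagonal, ← Matrix.diagonal_one]
  congr 1
  funext i
  rcases hZ.2 i with h | h <;> simp [Matrix.diag, h]

theorem pauliX_mul_self : pauliX * pauliX = 1 := by
  ext a b
  cases a <;> cases b <;> simp [pauliX, Matrix.mul_apply]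

theorem pauliZ_mul_pauliX : pauliZ * pauliX = -(pauliX * pauliZ) := by
  ext a b
  cases a <;> cases b <;> simp [pauliX, pauliZ]

/-- A type II tensor commutes with an odd involution on the bonds. -/
theorem exists_odd_symmetry {d b : ℕ} {ν : Type*} [Fintype ν] [DecidableEq ν] {p : Fin d → ZMod 2}
    {Z : Matrix ν ν ℂ} {U : Fin d → Fin d → Matrix ν ν ℂ} (e : ν ≃ Bool × Fin b)
    {Nm : Fin d → Fin d → Matrix (Fin b) (Fin b) ℂ}
    (hZ : Matrix.reindex e e Z = pauliZ ⊗ₖ (1 : Matrix (Fin b) (Fin b) ℂ))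
    (hU : ∀ n m, Matrix.reindex e e (U n m) = (pauliX ^ (p n + p m).val) ⊗ₖ Nm n m) :
    ∃ S : Matrix ν ν ℂ, S * S = 1 ∧ Z * S = -(S * Z) ∧ ∀ n m, S * U n m = U n m * S := by
  have hX : (pauliX ⊗ₖ (1 : Matrix (Fin b) (Fin b) ℂ)) * (pauliX ⊗ₖ 1) = 1 := by
    rw [← Matrix.mul_kronecker_mul, pauliX_mul_self, one_mul, Matrix.one_kronecker_one]
  have hinj := (Matrix.reindexAlgEquiv ℂ ℂ e).injective
  refine ⟨(Matrix.reindexAlgEquiv ℂ ℂ e).symm (pauliX ⊗ₖ 1), hinj ?_, hinj ?_,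
    fun n m => hinj ?_⟩
  · rw [map_mul, map_one, AlgEquiv.apply_symm_apply, hX]
  · rw [map_neg, map_mul, map_mul, AlgEquiv.apply_symm_apply, Matrix.coe_reindexAlgEquiv, hZ,
      ← Matrix.mul_kronecker_mul, ← Matrix.mul_kronecker_mul, pauliZ_mul_pauliX]
    ext
    simp
  · rw [map_mul, map_mul, AlgEquiv.apply_symm_apply, Matrix.coe_reindexAlgEquiv, hU,
      ← Matrix.mul_kronecker_mul, ← Matrix.mul_kronecker_mul, one_mul, mul_one,
      (Commute.self_pow pauliX _).eq]

/-- Every type I or type II fMPU with antiperiodic boundary conditions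
is locality-preserving (a one-dimensional fermionic QCA): there is a radius `r ≥ 1`,
independent of `N`, such that conjugation by the unitary `V^{(N)}` maps any homogeneous
single-site operator at site `j` to an operator supported (in the Jordan-Wigner sense)
on the window of radius `r` around `j`, with parity strings on the left and identities on
the right. -/
theorem fMPU_is_QCA {d D : ℕ} (hd : 1 ≤ d) (p : Fin d → ZMod 2)
    (Z : Matrix (Fin D) (Fin D) ℂ)
    (hZ : IsParityMatrix Z)
    (U : Fin d → Fin d → Matrix (Fin D) (Fin D) ℂ)
    (hE : EvenTensor (doubledP p) (doubledT U) Z)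
    (c : ℂ)
    (hc : (c = 1 ∧
            ∀ N : ℕ, 1 ≤ N → fMPO p U N ∈ Matrix.unitaryGroup (Fin N → Fin d) ℂ) ∨
          (c = ((Real.sqrt 2 : ℂ))⁻¹ ∧
            (∃ (b : ℕ) (e : Fin D ≃ Bool × Fin b)
                (Nm : Fin d → Fin d → Matrix (Fin b) (Fin b) ℂ),
              Matrix.reindex e e Z = pauliZ ⊗ₖ (1 : Matrix (Fin b) (Fin b) ℂ) ∧
              ∀ n m', Matrix.reindex e e (U n m') =
                (pauliX ^ (p n + p m').val) ⊗ₖ Nm n m') ∧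
            ∀ N : ℕ, 1 ≤ N →
              c • fMPO p U N ∈ Matrix.unitaryGroup (Fin N → Fin d) ℂ)) :
    ∃ r : ℕ, 1 ≤ r ∧
      ∀ (N : ℕ) (_hN : 2 * r < N) (j : Fin N)
        (hjl : r ≤ (j : ℕ)) (hjr : (j : ℕ) + r < N)
        (o : ZMod 2) (O : Matrix (Fin d) (Fin d) ℂ),
        singleP p * O * singleP p = sgn o • O →
        ∃ Ot : Matrix (Fin (2 * r + 1) → Fin d) (Fin (2 * r + 1) → Fin d) ℂ,
          bigP p (2 * r + 1) * Ot * bigP p (2 * r + 1) = sgn o • Ot ∧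
          ∀ n m : Fin N → Fin d,
            ((c • fMPO p U N)ᴴ * jordanWigner p o O j * (c • fMPO p U N)) n m =
              (∏ l ∈ Finset.univ.filter (fun l : Fin N => (l : ℕ) + r < (j : ℕ)),
                ((singleP p) ^ o.val) (n l) (m l)) *
              Ot (fun t => n ⟨(j : ℕ) - r + (t : ℕ), by have := t.isLt; omega⟩)
                 (fun t => m ⟨(j : ℕ) - r + (t : ℕ), by have := t.isLt; omega⟩) *
              (∏ l ∈ Finset.univ.filter (fun l : Fin N => (j : ℕ) + r < (l : ℕ)),
                (if n l = m l then (1 : ℂ) else 0)) := by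
  have hZZ := hZ.mul_self
  have hU : ∀ n m, Z * U n m = sgn (p n + p m) • (U n m * Z) := fun n m => hE (n, m)
  have habs : ∃ K, Absorbs (bilayer p Z U) diagInd ((⟨0, hd⟩ : Fin d), (⟨0, hd⟩ : Fin d)) K := by
    rcases hc with ⟨rfl, hunit⟩ | ⟨rfl, ⟨b, e, Nm, hZe, hUe⟩, hunit⟩
    · refine exists_absorbs _ _ (fun l hl => ?_) _ (if_pos rfl)
      rw [trace_prod_bilayer (c := 1) (τ := 1) hZZ hU (by simp)
        (fun N hN => by rw [one_smul]; exact hunit N hN) l hl, one_mul]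
    · obtain ⟨S, hS, hZS, hSU⟩ := exists_odd_symmetry e hZe hUe
      obtain ⟨T, hT, hTW, hTtr⟩ := exists_involution_of_odd_symmetry hZZ hU hS hZS hSU
      have hsq : (Real.sqrt 2 : ℂ) * (Real.sqrt 2 : ℂ) = 2 := by
        rw [← Complex.ofReal_mul, Real.mul_self_sqrt (by norm_num)]
        norm_num
      have hτ : (2 : ℂ) * (star ((Real.sqrt 2 : ℂ))⁻¹ * ((Real.sqrt 2 : ℂ))⁻¹) = 1 := by
        rw [star_inv₀, Complex.star_def, Complex.conj_ofReal, ← mul_inv, hsq]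
        norm_num
      exact exists_absorbs_of_involution _ _ hT hTW
        (trace_prod_bilayer hZZ hU hτ hunit) hTtr _ (if_pos rfl)
  obtain ⟨K, hK⟩ := habs
  refine ⟨max K 1, le_max_right _ _, fun N _ j hjl hjr o O hO => ?_⟩
  exact exists_local_conj hZZ hU (hK.mono (le_max_left _ _)) c j hjl hjr
    fun a b hab => apply_eq_zero_of_singleP_conj hO hab
end

end FQCA
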